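/- arXiv:2206.12499 — 3 statements merged into one kernel-verified Lean document; each statement's English description precedes it below -/
import Mathlib

section
/- Let k, ℓ ≥ 3. The number of (k,ℓ)-top-right-crucial permutations of length k+ℓ−2 equals (k+ℓ−4)². -/
/-- `σ` (in one-line notation, 0-based) has an increasing subsequence of length `k`,
i.e. contains an occurrence of the pattern `i_k`. -/
def HasIncr (k n : ℕ) (σ : Fin n → Fin n) : Prop :=
  ∃ f : Fin k → Fin n, StrictMono f ∧ StrictMono (σ ∘ f)

/-- `σ` has a decreasing subsequence of length `l`,
i.e. contains an occurrence of the pattern `d_l`. -/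
def HasDecr (l n : ℕ) (σ : Fin n → Fin n) : Prop :=
  ∃ f : Fin l → Fin n, StrictMono f ∧ StrictAnti (σ ∘ f)

/-- `σ` contains `i_k` or `d_l`. -/
def ContainsPat (k l n : ℕ) (σ : Fin n → Fin n) : Prop :=
  HasIncr k n σ ∨ HasDecr l n σ

/-- `σ` avoids both `i_k` and `d_l`. -/
def AvoidsPat (k l n : ℕ) (σ : Fin n → Fin n) : Prop :=
  ¬ HasIncr k n σ ∧ ¬ HasDecr l n σ

/-- The `i`-th extension of `σ` to the right (0-based): append the value `i` at the end,
renaming old values via `Fin.succAbove i` (i.e. `x ↦ x` if `x < i`, `x ↦ x+1` if `x ≥ i`). -/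
def rightExt {n : ℕ} (σ : Fin n → Fin n) (i : Fin (n + 1)) : Fin (n + 1) → Fin (n + 1) :=
  Fin.snoc (fun j => i.succAbove (σ j)) i

/-- The `i`-th extension of `σ` to the left: prepend the value `i`. -/
def leftExt {n : ℕ} (σ : Fin n → Fin n) (i : Fin (n + 1)) : Fin (n + 1) → Fin (n + 1) :=
  Fin.cons i (fun j => i.succAbove (σ j))

/-- The `i`-th extension of `σ` from above: insert the new maximum value at position `i`. -/
def topExt {n : ℕ} (σ : Fin n → Fin n) (i : Fin (n + 1)) : Fin (n + 1) → Fin (n + 1) :=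
  i.insertNth (Fin.last n) (fun j => (σ j).castSucc)

/-- The `i`-th extension of `σ` from below: insert the new minimum value at position `i`,
increasing all old values by one. -/
def botExt {n : ℕ} (σ : Fin n → Fin n) (i : Fin (n + 1)) : Fin (n + 1) → Fin (n + 1) :=
  i.insertNth 0 (fun j => (σ j).succ)

/-- `σ` is `(k,l)`-right-crucial (also called `(k,l)`-crucial): it avoids `i_k` and `d_l`,
but every extension of it to the right contains `i_k` or `d_l`. -/
def RightCrucial (k l n : ℕ) (σ : Fin n → Fin n) : Prop :=
  AvoidsPat k l n σ ∧ ∀ i : Fin (n + 1), ContainsPat k l (n + 1) (rightExt σ i)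

/-- `σ` is `(k,l)`-left-crucial. -/
def LeftCrucial (k l n : ℕ) (σ : Fin n → Fin n) : Prop :=
  AvoidsPat k l n σ ∧ ∀ i : Fin (n + 1), ContainsPat k l (n + 1) (leftExt σ i)

/-- `σ` is `(k,l)`-top-crucial. -/
def TopCrucial (k l n : ℕ) (σ : Fin n → Fin n) : Prop :=
  AvoidsPat k l n σ ∧ ∀ i : Fin (n + 1), ContainsPat k l (n + 1) (topExt σ i)

/-- `σ` is `(k,l)`-bottom-crucial. -/
def BottomCrucial (k l n : ℕ) (σ : Fin n → Fin n) : Prop :=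
  AvoidsPat k l n σ ∧ ∀ i : Fin (n + 1), ContainsPat k l (n + 1) (botExt σ i)

/-- `σ` is `(k,l)`-bicrucial: both right-crucial and left-crucial. -/
def Bicrucial (k l n : ℕ) (σ : Fin n → Fin n) : Prop :=
  RightCrucial k l n σ ∧ LeftCrucial k l n σ

/-- `σ` is `(k,l)`-top-right-crucial: right-crucial and every extension from above
contains `i_k` or `d_l`. -/
def TopRightCrucial (k l n : ℕ) (σ : Fin n → Fin n) : Prop :=
  RightCrucial k l n σ ∧ ∀ i : Fin (n + 1), ContainsPat k l (n + 1) (topExt σ i)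

/-- `σ` is `(k,l)`-tricrucial: bicrucial and every extension from above
contains `i_k` or `d_l`. -/
def Tricrucial (k l n : ℕ) (σ : Fin n → Fin n) : Prop :=
  Bicrucial k l n σ ∧ ∀ i : Fin (n + 1), ContainsPat k l (n + 1) (topExt σ i)

/-- `σ` is `(k,l)`-quadrocrucial: tricrucial and every extension from below
contains `i_k` or `d_l`. -/
def Quadrocrucial (k l n : ℕ) (σ : Fin n → Fin n) : Prop :=
  Tricrucial k l n σ ∧ ∀ i : Fin (n + 1), ContainsPat k l (n + 1) (botExt σ i)


set_option linter.unusedVariables false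

def rk (t p i : ℕ) : ℕ := if i < t then i else if i < p then i - 1 else i - 2
def un (t v q : ℕ) : ℕ := if q < t then q else if q + 1 < v then q + 1 else q + 2
def pp (K n r : ℕ) : ℕ := if r + 1 < K then r else n + K - 4 - r
def ff (K n t p v i : ℕ) : ℕ :=
  if i = t then v else if i = p then t else un t v (pp K n (rk t p i))

theorem un_rk (t p i : ℕ) (hp : t < p) (h1 : i ≠ t) (h2 : i ≠ p) : un t p (rk t p i) = i := by
  unfold un rk; split_ifs <;> omega
theorem rk_un (t p q : ℕ) (hp : t < p) : rk t p (un t p q) = q := by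
  unfold un rk; split_ifs <;> omega
theorem un_ne1 (t p q : ℕ) : un t p q ≠ t := by
  unfold un; split_ifs <;> omega
theorem un_ne2 (t p q : ℕ) (hp : t < p) : un t p q ≠ p := by
  unfold un; split_ifs <;> omega
theorem un_lt (t p n q : ℕ) (hq : q + 2 < n) : un t p q < n := by
  unfold un; split_ifs <;> omega
theorem un_mono (t p a b : ℕ) (h : a < b) : un t p a < un t p b := by
  unfold un; split_ifs <;> omega
theorem rk_mono (t p a b : ℕ) (hp : t < p) (h : a < b) (h1 : a ≠ t) (h2 : a ≠ p) (h3 : b ≠ t) (h4 : b ≠ p) :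
    rk t p a < rk t p b := by
  unfold rk; split_ifs <;> omega
theorem rk_lt (t p n i : ℕ) (ht : t < p) (hp : p < n) (h1 : i ≠ t) (h2 : i ≠ p) (hi : i < n) : rk t p i + 2 < n := by
  unfold rk; split_ifs <;> omega
theorem pp_pp (K L n r : ℕ) (hn : n = K + L + 2) (hK : 1 ≤ K) (hr : r + 2 < n) : pp K n (pp K n r) = r := by
  unfold pp; split_ifs <;> omega
theorem pp_lt (K L n r : ℕ) (hn : n = K + L + 2) (hK : 1 ≤ K) (hL : 1 ≤ L) (hr : r + 2 < n) : pp K n r + 2 < n := by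
  unfold pp; split_ifs <;> omega
theorem pp_cmp (K L n a b : ℕ) (hn : n = K + L + 2) (hK : 1 ≤ K) (h : a < b) (hr : b + 2 < n) :
    if a + 1 < K then pp K n a < pp K n b else pp K n b < pp K n a := by
  unfold pp; split_ifs <;> omega

section ffs
variable (K L n t p v : ℕ) (hn : n = K + L + 2) (hK : 1 ≤ K) (hL : 1 ≤ L)
    (ht : t < K) (hp : t < p) (hp' : p + 1 < n) (hv : t < v) (hv' : v + 1 < n)

theorem ff_t : ff K n t p v t = v := by simp [ff]

theorem ff_p (hp : t < p) : ff K n t p v p = t := by simp [ff, hp.ne']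

theorem ff_o (i : ℕ) (h1 : i ≠ t) (h2 : i ≠ p) : ff K n t p v i = un t v (pp K n (rk t p i)) := by
  simp [ff, h1, h2]

include hn hK hL ht hp hp' hv hv'

theorem ff_lt (i : ℕ) (hi : i < n) : ff K n t p v i < n := by
  by_cases h1 : i = t
  · rw [h1, ff_t]; omega
  by_cases h2 : i = p
  · rw [h2, ff_p _ _ _ _ _ hp]; omega
  rw [ff_o _ _ _ _ _ _ h1 h2]
  exact un_lt _ _ _ _ (pp_lt K L n _ hn hK hL (rk_lt t p n i hp (by omega) h1 h2 hi))

theorem ff_inv (i : ℕ) (hi : i < n) : ff K n t v p (ff K n t p v i) = i := by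
  by_cases h1 : i = t
  · rw [h1, ff_t, ff_p _ _ _ _ _ hv]
  by_cases h2 : i = p
  · rw [h2, ff_p _ _ _ _ _ hp, ff_t]
  have h3 := rk_lt t p n i hp (by omega) h1 h2 hi
  rw [ff_o _ _ _ _ _ _ h1 h2, ff_o _ _ _ _ _ _ (un_ne1 _ _ _) (un_ne2 _ _ _ hv), rk_un _ _ _ hv,
    pp_pp K L n _ hn hK h3, un_rk _ _ _ hp h1 h2]

theorem ff_cmp (i j : ℕ) (hij : i < j) (hj : j < n)
    (h1 : i ≠ t) (h2 : i ≠ p) (h3 : j ≠ t) (h4 : j ≠ p) :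
    ff K n t p v i < ff K n t p v j ↔ rk t p i + 1 < K := by
  rw [ff_o _ _ _ _ _ _ h1 h2, ff_o _ _ _ _ _ _ h3 h4]
  have a := rk_mono t p i j hp hij h1 h2 h3 h4
  have b := rk_lt t p n j hp (by omega) h3 h4 hj
  have c := pp_cmp K L n _ _ hn hK a b
  split_ifs at c with h
  · simp only [h, iff_true]; exact un_mono _ _ _ _ c
  · simp only [h, iff_false, not_lt]; exact (un_mono _ _ _ _ c).le

theorem ff_fix (i : ℕ) (hi : i < t) : ff K n t p v i = i := by
  rw [ff_o _ _ _ _ _ _ (by omega) (by omega)]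
  simp only [rk, pp, un, if_pos hi, if_pos (show i + 1 < K by omega)]

theorem ff_ge (i : ℕ) (hi : t ≤ i) (hin : i < n) : t ≤ ff K n t p v i := by
  by_contra h
  have a := ff_fix K L n t v p hn hK hL ht hv hv' hp hp' _ (not_le.mp h)
  rw [ff_inv K L n t p v hn hK hL ht hp hp' hv hv' i hin] at a
  omega

theorem ff_un (q : ℕ) : ff K n t p v (un t p q) = un t v (pp K n q) := by
  rw [ff_o _ _ _ _ _ _ (un_ne1 _ _ _) (un_ne2 _ _ _ hp), rk_un _ _ _ hp]

theorem ff_inj (i j : ℕ) (hi : i < n) (hj : j < n) (h : ff K n t p v i = ff K n t p v j) : i = j := by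
  rw [← ff_inv K L n t p v hn hK hL ht hp hp' hv hv' i hi, h, ff_inv K L n t p v hn hK hL ht hp hp' hv hv' j hj]

/-- cover by decreasing sequences -/
def colA (K t p i : ℕ) : ℕ := if i = t then K else if i = p then K else if rk t p i + 1 < K then rk t p i else K - 1

theorem colA_spec (i j : ℕ) (hij : i < j) (hj : j < n) (hc : colA K t p i = colA K t p j) :
    ff K n t p v j < ff K n t p v i := by
  by_cases h1 : i = t
  · by_cases h4 : j = p
    · rw [h1, h4, ff_t, ff_p _ _ _ _ _ hp]; exact hv
    · exfalso; unfold colA at hc; split_ifs at hc <;> omega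
  by_cases h2 : i = p
  · exfalso; unfold colA at hc; split_ifs at hc <;> omega
  by_cases h3 : j = t
  · exfalso; unfold colA at hc; split_ifs at hc <;> omega
  by_cases h4 : j = p
  · exfalso; unfold colA at hc; split_ifs at hc <;> omega
  have a := rk_mono t p i j hp hij h1 h2 h3 h4
  have b := ff_cmp K L n t p v hn hK hL ht hp hp' hv hv' i j hij hj h1 h2 h3 h4
  have d := ff_inj K L n t p v hn hK hL ht hp hp' hv hv' i j (by omega) hj
  have : ¬ (rk t p i + 1 < K) := by
    unfold colA at hc
    simp only [h1, h2, h3, h4, if_false] at hc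
    split_ifs at hc <;> omega
  omega

/-- cover by increasing sequences -/
def colB (K L t p i : ℕ) : ℕ := if i = t then 0 else if i = p then L else
  if rk t p i + 1 < K then (if p = t + 1 ∨ t + 1 = K then L else 0) else rk t p i + 1 - K

theorem colB_spec (hcond : t + 1 = K ∨ v = t + 1 ∨ p = t + 1) (i j : ℕ) (hij : i < j) (hj : j < n)
    (hc : colB K L t p i = colB K L t p j) :
    ff K n t p v i < ff K n t p v j := by
  have inj := ff_inj K L n t p v hn hK hL ht hp hp' hv hv'
  have fix := ff_fix K L n t p v hn hK hL ht hp hp' hv hv'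
  have ge := ff_ge K L n t p v hn hK hL ht hp hp' hv hv'
  have lt := ff_lt K L n t p v hn hK hL ht hp hp' hv hv'
  have et := ff_t K n t p v
  have ep := ff_p K n t p v hp
  have d := inj i j (by omega) hj
  have d1 := inj j t hj (by omega)
  have d2 := inj j p hj (by omega)
  have d3 := ge j
  have d4 := fix i
  have d5 := fix j
  by_cases h0 : i < t
  · omega
  by_cases h1 : i = t
  · by_cases h4 : j = p
    · exfalso; unfold colB at hc; split_ifs at hc <;> omega
    by_cases hr : rk t p j + 1 < K
    · have : v = t + 1 := by
        unfold colB at hc; split_ifs at hc <;> omega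
      rw [h1]
      omega
    · have : rk t p j + 1 = K := by
        unfold colB at hc; split_ifs at hc <;> omega
      rw [h1, et, ff_o K n t p v j (by omega) h4]
      unfold pp un
      split_ifs <;> omega
  by_cases h2 : i = p
  · rw [h2]; omega
  by_cases h3 : j = t
  · omega
  by_cases h4 : j = p
  · exfalso; unfold colB rk at hc; split_ifs at hc <;> omega
  have a := rk_mono t p i j hp hij h1 h2 h3 h4
  rw [ff_cmp K L n t p v hn hK hL ht hp hp' hv hv' i j hij hj h1 h2 h3 h4]
  unfold colB at hc; split_ifs at hc <;> omega

theorem exI (hcond : t + 1 = K ∨ v = t + 1 ∨ p = t + 1) : ∃ g : ℕ → ℕ, (∀ a ≤ K, g a < n) ∧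
    g K = n - 1 ∧
    ∀ a b, a < b → b ≤ K → g a < g b ∧ ff K n t p v (g a) < ff K n t p v (g b) := by
  have fix := ff_fix K L n t p v hn hK hL ht hp hp' hv hv'
  have fun' := ff_un K L n t p v hn hK hL ht hp hp' hv hv'
  have et := ff_t K n t p v
  have ep := ff_p K n t p v hp
  obtain ⟨w, hw, hw'⟩ : ∃ w, ((w = t ∧ v = t + 1) ∨ (w = p ∧ (t + 1 = K ∨ p = t + 1))) ∧
    t ≤ w := by
    rcases hcond with h | h | h
    · exact ⟨p, by omega, by omega⟩
    · exact ⟨t, by omega, by omega⟩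
    · exact ⟨p, by omega, by omega⟩
  refine ⟨fun j => if j < t then j else if j = t then w else if j = K then n - 1 else un t p (j - 1), ?_, ?_, ?_⟩
  · intro a ha
    dsimp only
    split_ifs
    · omega
    · omega
    · omega
    · exact un_lt _ _ _ _ (by omega)
  · dsimp only
    split_ifs <;> omega
  · have eZ : un t p (n - 3) = n - 1 := by unfold un; split_ifs <;> omega
    have fZ : ff K n t p v (n - 1) = un t v (K - 1) := by
      rw [← eZ, fun']; congr 1; unfold pp; split_ifs <;> omega
    have fU : ∀ q, q + 1 < K → ff K n t p v (un t p q) = un t v q := by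
      intro q hq
      rw [fun']; congr 1; unfold pp; split_ifs; rfl
    have ew : w = t ∧ ff K n t p v w = v ∨ w = p ∧ ff K n t p v w = t := by
      rcases hw with ⟨h, _⟩ | ⟨h, _⟩
      · left; exact ⟨h, by rw [h, et]⟩
      · right; exact ⟨h, by rw [h, ep]⟩
    intro a b hab hb
    dsimp only
    by_cases a1 : a < t
    · rw [if_pos a1, fix a a1]
      split_ifs with b1 b2 b3
      · rw [fix b b1]; omega
      · omega
      · rw [fZ]; unfold un; split_ifs <;> omega
      · rw [fU _ (by omega)]; unfold un; split_ifs <;> omega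
    · rw [if_neg a1, if_neg (show ¬ b < t by omega), if_neg (show ¬ b = t by omega), if_neg (show ¬ a = K by omega)]
      by_cases a2 : a = t
      · rw [if_pos a2]
        split_ifs with b3
        · rw [fZ]; unfold un; split_ifs <;> omega
        · rw [fU _ (by omega)]; unfold un; split_ifs <;> omega
      · rw [if_neg a2, fU _ (by omega)]
        split_ifs with b3
        · rw [fZ, ← eZ]; exact ⟨un_mono _ _ _ _ (by omega), un_mono _ _ _ _ (by omega)⟩
        · rw [fU _ (by omega)]; exact ⟨un_mono _ _ _ _ (by omega), un_mono _ _ _ _ (by omega)⟩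

theorem exD : ∃ g : ℕ → ℕ, (∀ a ≤ L, g a < n) ∧
    g L = n - 1 ∧
    ∀ a b, a < b → b ≤ L → g a < g b ∧ ff K n t p v (g b) < ff K n t p v (g a) := by
  have fun' := ff_un K L n t p v hn hK hL ht hp hp' hv hv'
  refine ⟨fun j => un t p (K - 1 + j), ?_, ?_, ?_⟩
  · intro a ha; exact un_lt _ _ _ _ (by omega)
  · dsimp only; unfold un; split_ifs <;> omega
  · intro a b hab hb
    dsimp only
    refine ⟨un_mono _ _ _ _ (by omega), ?_⟩
    rw [fun', fun']
    apply un_mono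
    unfold pp
    split_ifs <;> omega
end ffs

/-- Data extracted from right cruciality -/
structure RR (K n : ℕ) (s : ℕ → ℕ) (c e : ℕ) : Prop where
  z : s (n - 1) = c
  he : e < n - 1
  hc : (c = K ∧ K < s e) ∨ (c = K + 1 ∧ s e < K + 1)
  lo : ∀ i j, i < j → j < n - 1 → i ≠ e → j ≠ e → s i < c → s j < c → s i < s j
  up : ∀ i j, i < j → j < n - 1 → i ≠ e → j ≠ e → c < s i → c < s j → s j < s i
  nd : c = K → ∃ i j, i < j ∧ j < n - 1 ∧ c < s i ∧ s i < s j
  ni : c = K + 1 → ∃ i j, i < j ∧ j < n - 1 ∧ s j < s i ∧ s i < c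

def GoodP (K n : ℕ) (s : ℕ → ℕ) : Prop :=
  ∃ t p v, t < K ∧ t < p ∧ p + 1 < n ∧ t < v ∧ v + 1 < n ∧ s t = v ∧ s p = t ∧
    (t + 1 = K ∨ v = t + 1 ∨ p = t + 1) ∧
    ∀ i j, i < j → j < n → i ≠ t → i ≠ p → j ≠ t → j ≠ p → (s i < s j ↔ rk t p i + 1 < K)

theorem exists_t (n : ℕ) (s r : ℕ → ℕ) (hs : ∀ i < n, s i < n) (hr : ∀ i < n, r i < n)
   (hrs : ∀ i < n, r (s i) = i) (hsr : ∀ i < n, s (r i) = i) (a : ℕ) (ha : a < n) (hsa : s a ≠ a) :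
   ∃ t, t ≤ a ∧ t < s t ∧ t < r t ∧ (∀ i < t, s i = i) ∧ (∀ i < n, t ≤ i → t ≤ s i) := by
  classical
  have hex : ∃ a, s a ≠ a := ⟨a, hsa⟩
  have hmin : ∀ i < Nat.find hex, s i = i := fun i hi => by simpa using Nat.find_min hex hi
  have hle := Nat.find_min' hex hsa
  have hne := Nat.find_spec hex
  generalize Nat.find hex = t at *
  have key : ∀ i < n, t ≤ i → t ≤ s i := by
    intro i hi hti
    by_contra hlt
    have h1 := hmin (s i) (by omega)
    have h2 := hrs (s i) (hs i hi)
    rw [h1, hrs i hi] at h2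
    omega
  refine ⟨t, hle, ?_, ?_, hmin, key⟩
  · have := key t (by omega) le_rfl
    omega
  · have h1 := hsr t (by omega)
    rcases lt_trichotomy (r t) t with h | h | h
    · have := hmin _ h; omega
    · rw [h] at h1; omega
    · exact h

section cases
variable (K L n : ℕ) (s r : ℕ → ℕ)

theorem case_a (hn : n = K + L + 2) (hK : 1 ≤ K) (hL : 1 ≤ L) (hs : ∀ i < n, s i < n) (hr : ∀ i < n, r i < n)
   (hrs : ∀ i < n, r (s i) = i) (hsr : ∀ i < n, s (r i) = i) (e e' : ℕ)
   (h1 : RR K n s K e) (h2 : RR K n r K e')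
   (hav : ∀ i j, K ≤ i → i < j → j < n → (∀ a < K, s a = a) → s j < s i) : GoodP K n s := by
  have hz := h1.z
  have hm := h2.z
  have hM : s K = n - 1 := by have := hsr (n-1) (by omega); rwa [hm] at this
  have hse : K < s e := by rcases h1.hc with h | h <;> omega
  have hre : K < r e' := by rcases h2.hc with h | h <;> omega
  have he := h1.he
  have inj : ∀ i j, i < n → j < n → s i = s j → i = j := by
    intro i j hi hj h
    rw [← hrs i hi, ← hrs j hj, h]
  have lows : ∀ i j, i < j → j < n - 1 → s i < K → s j < K → s i < s j := by
    intro i j a b c d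
    exact h1.lo i j a b (by rintro rfl; omega) (by rintro rfl; omega) c d
  have poss : ∀ i j, i < j → j < K → s i < s j := by
    intro i j hij hj
    by_contra hlt
    have hne : s i ≠ s j := fun h => by have := inj i j (by omega) (by omega) h; omega
    have hi1 := hrs i (by omega)
    have hj1 := hrs j (by omega)
    have := hs i (by omega)
    have hin : s i ≠ n - 1 := fun h => by rw [h, hm] at hi1; omega
    have := h2.lo (s j) (s i) (by omega) (by omega) (by rintro h; rw [← h] at hre; omega) (by rintro h; rw [← h] at hre; omega)
      (by omega) (by omega)
    omega
  obtain ⟨t, hta, htv, htp, hfix, hge⟩ := exists_t n s r hs hr hrs hsr (n-1) (by omega) (by omega)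
  have htn : t < n := by omega
  have hp1 := hr t htn
  have hv1 := hs t htn
  have hsp := hsr t htn
  have hrv := hrs t htn
  obtain ⟨p, hp⟩ : ∃ p, p = r t := ⟨_, rfl⟩
  obtain ⟨v, hv⟩ : ∃ v, v = s t := ⟨_, rfl⟩
  rw [← hp] at hp1 hsp htp
  rw [← hv] at hv1 hrv htv
  have htK : t < K := by
    by_contra hcon
    obtain ⟨i, j, hij, hj, hci, hcj⟩ := h1.nd rfl
    have hi : K ≤ i := by
      by_contra h
      have := hfix i (by omega); omega
    have := hav i j hi hij (by omega) (fun a ha => hfix a (by omega))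
    omega
  have hpn : p ≠ n - 1 := by rintro rfl; omega
  have hvn : v ≠ n - 1 := by
    intro h; have := inj t K (by omega) (by omega) (by omega); omega
  have hvK : K < v := by
    have : v ≠ K := fun h => by have := inj t (n-1) (by omega) (by omega) (by omega); omega
    by_contra h
    have := lows t p htp (by omega) (by omega) (by omega)
    omega
  have hpK : K < p := by
    have : p ≠ K := by rintro rfl; omega
    by_contra h
    have := poss t p htp (by omega)
    omega
  have htt : t + 1 = K := by
    by_contra h
    have a1 := poss t (t+1) (by omega) (by omega)
    have b1 : s (t+1) < n := hs _ (by omega)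
    have b2 : s (t+1) ≠ n - 1 := fun h => by have := inj (t+1) K (by omega) (by omega) (by omega); omega
    have a2 := h1.up t (t+1) (by omega) (by omega)
    have a3 := h1.up t K (by omega) (by omega)
    have a4 := h1.up (t+1) K (by omega) (by omega)
    omega
  have het : e = t ∨ e = K := by
    have a3 := h1.up t K (by omega) (by omega)
    omega
  refine ⟨t, p, v, htK, htp, by omega, htv, by omega, hv.symm, hsp, Or.inl htt, ?_⟩
  intro i j hij hj hit hip hjt hjp
  have hsj : s j < n := hs j hj
  have hup : ∀ i < n, K ≤ i → i ≠ p → i ≠ n - 1 → K < s i := by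
    intro i hi h1' h2' h3'
    have b1 := hge i hi (by omega)
    have b2 : s i ≠ t := fun h => by have := inj i p (by omega) (by omega) (by omega); omega
    have b2 : s i ≠ K := fun h => by have := inj i (n-1) (by omega) (by omega) (by omega); omega
    omega
  have hne : s i ≠ s j := fun h => by have := inj i j (by omega) (by omega) h; omega
  unfold rk
  by_cases hiK : i < t
  · have a1 := hfix i hiK
    have : i < s j := by
      by_cases hjt' : j < t
      · rw [hfix j hjt']; exact hij
      · have := hge j hj (by omega); omega
    rw [if_pos hiK]; omega
  · have a1 := hup i (by omega) (by omega) hip (by omega)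
    have : s j < s i := by
      by_cases hj1 : j = n - 1
      · subst hj1; omega
      · have a2 := hup j (by omega) (by omega) hjp hj1
        by_cases hi1 : i = K
        · subst hi1; omega
        · exact h1.up i j hij (by omega) (by omega) (by omega) a1 a2
    rw [if_neg hiK]
    split_ifs <;> omega

theorem case_b (hn : n = K + L + 2) (hK : 1 ≤ K) (hL : 1 ≤ L) (hs : ∀ i < n, s i < n) (hr : ∀ i < n, r i < n)
   (hrs : ∀ i < n, r (s i) = i) (hsr : ∀ i < n, s (r i) = i) (e e' : ℕ)
   (h1 : RR K n s K e) (h2 : RR K n r (K+1) e') : GoodP K n s := by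
  have hz := h1.z
  have hm := h2.z
  have hM : s (K+1) = n - 1 := by have := hsr (n-1) (by omega); rwa [hm] at this
  have hse : K < s e := by rcases h1.hc with h | h <;> omega
  have hre : r e' < K + 1 := by rcases h2.hc with h | h <;> omega
  have he := h1.he
  have inj : ∀ i j, i < n → j < n → s i = s j → i = j := by
    intro i j hi hj h
    rw [← hrs i hi, ← hrs j hj, h]
  have lows : ∀ i j, i < j → j < n - 1 → s i < K → s j < K → s i < s j := by
    intro i j a b c d
    exact h1.lo i j a b (by rintro rfl; omega) (by rintro rfl; omega) c d
  have poss : ∀ i j, i < j → K + 1 < i → j < n → s j < s i := by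
    intro i j hij hi hj
    by_contra hlt
    have hne : s i ≠ s j := fun h => by have := inj i j (by omega) (by omega) h; omega
    have hi1 := hrs i (by omega)
    have hj1 := hrs j (by omega)
    have := hs j (by omega)
    have hin : s j ≠ n - 1 := fun h => by rw [h, hm] at hj1; omega
    have := h2.up (s i) (s j) (by omega) (by omega) (by rintro h; rw [← h] at hre; omega) (by rintro h; rw [← h] at hre; omega)
      (by omega) (by omega)
    omega
  obtain ⟨t, hta, htv, htp, hfix, hge⟩ := exists_t n s r hs hr hrs hsr (K+1) (by omega) (by omega)
  have htn : t < n := by omega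
  have hp1 := hr t htn
  have hv1 := hs t htn
  have hsp := hsr t htn
  have hrv := hrs t htn
  obtain ⟨p, hp⟩ : ∃ p, p = r t := ⟨_, rfl⟩
  obtain ⟨v, hv⟩ : ∃ v, v = s t := ⟨_, rfl⟩
  rw [← hp] at hp1 hsp htp
  rw [← hv] at hv1 hrv htv
  have htK : t < K := by
    by_contra hcon
    obtain ⟨x, y, hxy, hy, hc1, hc2⟩ := h2.ni rfl
    have e1 := hsr x (by omega)
    have e2 := hsr y (by omega)
    have e3 := hfix (r y) (by omega)
    by_cases h : r x < t
    · have e4 := hfix (r x) h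
      omega
    · have := hge (r x) (by omega) (by omega)
      omega
  have low1 : ∀ i < n, s i < K → i ≤ K := by
    intro i hi h
    by_contra hc
    have : i ≠ K + 1 := by rintro rfl; omega
    have : i ≠ n - 1 := by rintro rfl; omega
    have := poss i (n-1) (by omega) (by omega) (by omega)
    omega
  have hpK : p ≤ K := low1 p hp1 (by omega)
  have hvn : v ≠ n - 1 := by
    intro h; have := inj t (K+1) (by omega) (by omega) (by omega); omega
  have hvK : K < v := by
    have : v ≠ K := fun h => by have := inj t (n-1) (by omega) (by omega) (by omega); omega
    by_contra h
    have := lows t p htp (by omega) (by omega) (by omega)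
    omega
  have low2 : ∀ i ≤ K, i ≠ t → s i < K := by
    have hsub : Finset.range K ⊆ ((Finset.range (K+1)).erase t).image s := by
      intro x hx
      simp only [Finset.mem_range] at hx
      simp only [Finset.mem_image, Finset.mem_erase, Finset.mem_range]
      have hx2 := hsr x (by omega)
      refine ⟨r x, ⟨?_, ?_⟩, hx2⟩
      · rintro h; rw [h] at hx2; omega
      · have := low1 (r x) (hr x (by omega)) (by omega); omega
    have hcard : (((Finset.range (K+1)).erase t).image s).card ≤ (Finset.range K).card := by
      refine Finset.card_image_le.trans ?_
      rw [Finset.card_erase_of_mem (by simp; omega)]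
      simp
    have := Finset.eq_of_subset_of_card_le hsub hcard
    intro i hi hit
    have : s i ∈ Finset.range K := by
      rw [this]
      exact Finset.mem_image_of_mem _ (by simp; omega)
    simpa using this
  have hpt : p = t + 1 := by
    by_contra h
    have a1 := low2 (t+1) (by omega) (by omega)
    have := lows (t+1) p (by omega) (by omega) a1 (by omega)
    have := hge (t+1) (by omega) (by omega)
    omega
  refine ⟨t, p, v, htK, htp, by omega, htv, by omega, hv.symm, hsp, Or.inr (Or.inr hpt), ?_⟩
  intro i j hij hj hit hip hjt hjp
  have hsj : s j < n := hs j hj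
  have hne : s i ≠ s j := fun h => by have := inj i j (by omega) (by omega) h; omega
  unfold rk
  by_cases hiK : i ≤ K
  · have a1 := low2 i hiK hit
    have : s i < s j := by
      by_cases hjK : j ≤ K
      · exact lows i j hij (by omega) a1 (low2 j hjK hjt)
      · by_contra hc
        have := low1 j hj (by omega)
        omega
    split_ifs <;> omega
  · have : s j < s i := by
      by_cases hi1 : i = K + 1
      · subst hi1; omega
      · exact poss i j hij (by omega) hj
    split_ifs <;> omega

theorem case_d (hn : n = K + L + 2) (hK : 1 ≤ K) (hL : 1 ≤ L) (hs : ∀ i < n, s i < n) (hr : ∀ i < n, r i < n)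
   (hrs : ∀ i < n, r (s i) = i) (hsr : ∀ i < n, s (r i) = i) (e e' : ℕ)
   (h1 : RR K n s (K+1) e) (h2 : RR K n r (K+1) e') : GoodP K n s := by
  have hz := h1.z
  have hm := h2.z
  have hM : s (K+1) = n - 1 := by have := hsr (n-1) (by omega); rwa [hm] at this
  have hse : s e < K + 1 := by rcases h1.hc with h | h <;> omega
  have hre : r e' < K + 1 := by rcases h2.hc with h | h <;> omega
  have he := h1.he
  have inj : ∀ i j, i < n → j < n → s i = s j → i = j := by
    intro i j hi hj h
    rw [← hrs i hi, ← hrs j hj, h]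
  have poss : ∀ i j, i < j → K + 1 < i → j < n → s j < s i := by
    intro i j hij hi hj
    by_contra hlt
    have hne : s i ≠ s j := fun h => by have := inj i j (by omega) (by omega) h; omega
    have hi1 := hrs i (by omega)
    have hj1 := hrs j (by omega)
    have := hs j (by omega)
    have hin : s j ≠ n - 1 := fun h => by rw [h, hm] at hj1; omega
    have := h2.up (s i) (s j) (by omega) (by omega) (by rintro h; rw [← h] at hre; omega) (by rintro h; rw [← h] at hre; omega)
      (by omega) (by omega)
    omega
  obtain ⟨t, hta, htv, htp, hfix, hge⟩ := exists_t n s r hs hr hrs hsr (K+1) (by omega) (by omega)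
  have htn : t < n := by omega
  have hp1 := hr t htn
  have hv1 := hs t htn
  have hsp := hsr t htn
  have hrv := hrs t htn
  obtain ⟨p, hp⟩ : ∃ p, p = r t := ⟨_, rfl⟩
  obtain ⟨v, hv⟩ : ∃ v, v = s t := ⟨_, rfl⟩
  rw [← hp] at hp1 hsp htp
  rw [← hv] at hv1 hrv htv
  have htK : t < K := by
    by_contra hcon
    obtain ⟨x, y, hxy, hy, hc1, hc2⟩ := h2.ni rfl
    have e1 := hsr x (by omega)
    have e2 := hsr y (by omega)
    have e3 := hfix (r y) (by omega)
    by_cases h : r x < t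
    · have e4 := hfix (r x) h
      omega
    · have := hge (r x) (by omega) (by omega)
      omega
  have low1 : ∀ i < n, s i < K + 1 → i ≤ K := by
    intro i hi h
    by_contra hc
    have : i ≠ K + 1 := by rintro rfl; omega
    have : i ≠ n - 1 := by rintro rfl; omega
    have := poss i (n-1) (by omega) (by omega) (by omega)
    omega
  have low2 : ∀ i ≤ K, s i < K + 1 := by
    intro i hi
    by_contra hc
    have a1 : s i ≠ K + 1 := fun h => by have := inj i (n-1) (by omega) (by omega) (by omega); omega
    have a2 := h1.up i (K+1) (by omega) (by omega) (by rintro rfl; omega) (by rintro rfl; omega) (by omega) (by omega)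
    have := hs i (by omega)
    omega
  have hpK : p ≤ K := low1 p hp1 (by omega)
  have hvK : v ≤ K := by have := low2 t (by omega); omega
  have het : e = t ∨ e = p := by
    by_contra h
    have := h1.lo t p htp (by omega) (by omega) (by omega) (by omega) (by omega)
    omega
  have hcond : v = t + 1 ∨ p = t + 1 := by
    rcases het with h | h
    · right
      by_contra hc
      have := h1.lo (t+1) p (by omega) (by omega) (by omega) (by omega) (low2 _ (by omega)) (by omega)
      have := hge (t+1) (by omega) (by omega)
      omega
    · left
      by_contra hc
      have a1 := hsr (t+1) (by omega)
      have a2 := hr (t+1) (by omega)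
      generalize r (t+1) = q at *
      have : ¬ q < t := fun h => by have := hfix q h; omega
      have : q ≠ t := by rintro rfl; omega
      have : q ≠ p := by rintro rfl; omega
      have := low1 q a2 (by omega)
      have := h1.lo t q (by omega) (by omega) (by omega) (by omega) (by omega) (by omega)
      omega
  refine ⟨t, p, v, htK, htp, by omega, htv, by omega, hv.symm, hsp, Or.inr hcond, ?_⟩
  intro i j hij hj hit hip hjt hjp
  have hsj : s j < n := hs j hj
  have hne : s i ≠ s j := fun h => by have := inj i j (by omega) (by omega) h; omega
  unfold rk
  by_cases hiK : i ≤ K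
  · have a1 := low2 i hiK
    have : s i < s j := by
      by_cases hjK : j ≤ K
      · exact h1.lo i j hij (by omega) (by omega) (by omega) a1 (low2 j hjK)
      · by_contra hc
        have := low1 j hj (by omega)
        omega
    split_ifs <;> omega
  · have : s j < s i := by
      by_cases hi1 : i = K + 1
      · subst hi1; omega
      · exact poss i j hij (by omega) hj
    split_ifs <;> omega
end cases
set_option linter.unusedSectionVars false
theorem hasIncr_of_set {k n : ℕ} {σ : Fin n → Fin n} (S : Finset (Fin n)) (hc : S.card = k)
    (h : ∀ i ∈ S, ∀ j ∈ S, i < j → σ i < σ j) : HasIncr k n σ := by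
  refine ⟨S.orderEmbOfFin hc, (S.orderEmbOfFin hc).strictMono, fun a b hab => ?_⟩
  exact h _ (S.orderEmbOfFin_mem hc a) _ (S.orderEmbOfFin_mem hc b) ((S.orderEmbOfFin hc).strictMono hab)

theorem hasDecr_of_set {k n : ℕ} {σ : Fin n → Fin n} (S : Finset (Fin n)) (hc : S.card = k)
    (h : ∀ i ∈ S, ∀ j ∈ S, i < j → σ j < σ i) : HasDecr k n σ := by
  refine ⟨S.orderEmbOfFin hc, (S.orderEmbOfFin hc).strictMono, fun a b hab => ?_⟩
  exact h _ (S.orderEmbOfFin_mem hc a) _ (S.orderEmbOfFin_mem hc b) ((S.orderEmbOfFin hc).strictMono hab)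

theorem rightExt_castSucc {n : ℕ} (σ : Fin n → Fin n) (i : Fin (n+1)) (x : Fin n) :
    rightExt σ i x.castSucc = i.succAbove (σ x) := by simp [rightExt]
theorem rightExt_last {n : ℕ} (σ : Fin n → Fin n) (i : Fin (n+1)) :
    rightExt σ i (Fin.last n) = i := by simp [rightExt]

theorem lower_seq {m n : ℕ} (f : Fin m → Fin (n+1)) (hf : ∀ j, f j ≠ Fin.last n) :
    ∃ g : Fin m → Fin n, ∀ j, f j = (g j).castSucc :=
  ⟨fun j => (f j).castPred (hf j), fun j => by simp⟩

theorem incr_of_ext {m n : ℕ} {σ : Fin n → Fin n} {i : Fin (n+1)}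
    (h : HasIncr (m+1) (n+1) (rightExt σ i)) (h' : ¬ HasIncr (m+1) n σ) :
    ∃ S : Finset (Fin n), S.card = m ∧ (∀ a ∈ S, ∀ b ∈ S, a < b → σ a < σ b) ∧
      ∀ a ∈ S, (σ a).val < i.val := by
  obtain ⟨f, hf, hσ⟩ := h
  by_cases hl : f (Fin.last m) = Fin.last n
  · obtain ⟨g, hg⟩ := lower_seq (fun j : Fin m => f j.castSucc) (fun j h => by
      have := hf (Fin.castSucc_lt_last j)
      rw [h, hl] at this; exact lt_irrefl _ this)
    have hgm : StrictMono g := fun a b hab => by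
      have := hf (Fin.castSucc_lt_castSucc_iff.mpr hab)
      rw [hg, hg] at this; simpa using this
    refine ⟨Finset.univ.image g, ?_, ?_, ?_⟩
    · rw [Finset.card_image_of_injective _ hgm.injective]; simp
    · simp only [Finset.mem_image, Finset.mem_univ, true_and]
      rintro _ ⟨a, rfl⟩ _ ⟨b, rfl⟩ hab
      have := hσ (Fin.castSucc_lt_castSucc_iff.mpr (hgm.lt_iff_lt.mp hab))
      simp only [Function.comp, hg, rightExt_castSucc] at this
      simpa using this
    · simp only [Finset.mem_image, Finset.mem_univ, true_and]
      rintro _ ⟨a, rfl⟩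
      have := hσ (Fin.castSucc_lt_last a)
      simp only [Function.comp, hg, rightExt_castSucc, hl, rightExt_last, Fin.succAbove_lt_iff_castSucc_lt] at this
      exact this
  · exfalso
    apply h'
    obtain ⟨g, hg⟩ := lower_seq f (fun j h => by
      have := hf.monotone (Fin.le_last j)
      rw [h] at this; exact hl (le_antisymm (Fin.le_last _) this))
    refine ⟨g, fun a b hab => ?_, fun a b hab => ?_⟩
    · have := hf hab
      rw [hg, hg] at this; simpa using this
    · have := hσ hab
      simp only [Function.comp, hg, rightExt_castSucc] at this
      simpa using this

theorem decr_of_ext {m n : ℕ} {σ : Fin n → Fin n} {i : Fin (n+1)}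
    (h : HasDecr (m+1) (n+1) (rightExt σ i)) (h' : ¬ HasDecr (m+1) n σ) :
    ∃ S : Finset (Fin n), S.card = m ∧ (∀ a ∈ S, ∀ b ∈ S, a < b → σ b < σ a) ∧
      ∀ a ∈ S, i.val ≤ (σ a).val := by
  obtain ⟨f, hf, hσ⟩ := h
  by_cases hl : f (Fin.last m) = Fin.last n
  · obtain ⟨g, hg⟩ := lower_seq (fun j : Fin m => f j.castSucc) (fun j h => by
      have := hf (Fin.castSucc_lt_last j)
      rw [h, hl] at this; exact lt_irrefl _ this)
    have hgm : StrictMono g := fun a b hab => by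
      have := hf (Fin.castSucc_lt_castSucc_iff.mpr hab)
      rw [hg, hg] at this; simpa using this
    refine ⟨Finset.univ.image g, ?_, ?_, ?_⟩
    · rw [Finset.card_image_of_injective _ hgm.injective]; simp
    · simp only [Finset.mem_image, Finset.mem_univ, true_and]
      rintro _ ⟨a, rfl⟩ _ ⟨b, rfl⟩ hab
      have := hσ (Fin.castSucc_lt_castSucc_iff.mpr (hgm.lt_iff_lt.mp hab))
      simp only [Function.comp, hg, rightExt_castSucc] at this
      simpa using this
    · simp only [Finset.mem_image, Finset.mem_univ, true_and]
      rintro _ ⟨a, rfl⟩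
      have := hσ (Fin.castSucc_lt_last a)
      simp only [Function.comp, hg, rightExt_castSucc, hl, rightExt_last, Fin.lt_succAbove_iff_le_castSucc] at this
      exact this
  · exfalso
    apply h'
    obtain ⟨g, hg⟩ := lower_seq f (fun j h => by
      have := hf.monotone (Fin.le_last j)
      rw [h] at this; exact hl (le_antisymm (Fin.le_last _) this))
    refine ⟨g, fun a b hab => ?_, fun a b hab => ?_⟩
    · have := hf hab
      rw [hg, hg] at this; simpa using this
    · have := hσ hab
      simp only [Function.comp, hg, rightExt_castSucc] at this
      simpa using this

theorem ext_incr {m n : ℕ} {σ : Fin n → Fin n} {i : Fin (n+1)} (g : ℕ → ℕ) (s : ℕ → ℕ)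
    (hs : ∀ x : Fin n, (σ x).val = s x.val) (hg : ∀ a < m, g a < n)
    (hm : ∀ a b, a < b → b < m → g a < g b ∧ s (g a) < s (g b)) (hi : ∀ a < m, s (g a) < i.val) :
    HasIncr (m+1) (n+1) (rightExt σ i) := by
  refine ⟨Fin.snoc (fun j : Fin m => (⟨g j, hg j j.2⟩ : Fin n).castSucc) (Fin.last n), ?_, ?_⟩
  · intro a b hab
    induction b using Fin.lastCases with
    | last =>
      induction a using Fin.lastCases with
      | last => exact absurd hab (lt_irrefl _)
      | cast a => simp only [Fin.snoc_castSucc, Fin.snoc_last]; exact Fin.castSucc_lt_last _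
    | cast b =>
      induction a using Fin.lastCases with
      | last => exact absurd hab (not_lt.mpr (Fin.le_last _))
      | cast a =>
        simp only [Fin.snoc_castSucc]
        exact (hm a b (by simpa using hab) b.2).1
  · intro a b hab
    induction b using Fin.lastCases with
    | last =>
      induction a using Fin.lastCases with
      | last => exact absurd hab (lt_irrefl _)
      | cast a =>
        simp only [Function.comp, Fin.snoc_castSucc, Fin.snoc_last, rightExt_castSucc, rightExt_last, Fin.succAbove_lt_iff_castSucc_lt]
        have := hi a a.2
        rw [Fin.lt_def, Fin.val_castSucc, hs]; exact this
    | cast b =>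
      induction a using Fin.lastCases with
      | last => exact absurd hab (not_lt.mpr (Fin.le_last _))
      | cast a =>
        simp only [Function.comp, Fin.snoc_castSucc, rightExt_castSucc, Fin.succAbove_lt_succAbove_iff]
        rw [Fin.lt_def, hs, hs]
        exact (hm a b (by simpa using hab) b.2).2

theorem ext_decr {m n : ℕ} {σ : Fin n → Fin n} {i : Fin (n+1)} (g : ℕ → ℕ) (s : ℕ → ℕ)
    (hs : ∀ x : Fin n, (σ x).val = s x.val) (hg : ∀ a < m, g a < n)
    (hm : ∀ a b, a < b → b < m → g a < g b ∧ s (g b) < s (g a)) (hi : ∀ a < m, i.val ≤ s (g a)) :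
    HasDecr (m+1) (n+1) (rightExt σ i) := by
  refine ⟨Fin.snoc (fun j : Fin m => (⟨g j, hg j j.2⟩ : Fin n).castSucc) (Fin.last n), ?_, ?_⟩
  · intro a b hab
    induction b using Fin.lastCases with
    | last =>
      induction a using Fin.lastCases with
      | last => exact absurd hab (lt_irrefl _)
      | cast a => simp only [Fin.snoc_castSucc, Fin.snoc_last]; exact Fin.castSucc_lt_last _
    | cast b =>
      induction a using Fin.lastCases with
      | last => exact absurd hab (not_lt.mpr (Fin.le_last _))
      | cast a =>
        simp only [Fin.snoc_castSucc]
        exact (hm a b (by simpa using hab) b.2).1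
  · intro a b hab
    induction b using Fin.lastCases with
    | last =>
      induction a using Fin.lastCases with
      | last => exact absurd hab (lt_irrefl _)
      | cast a =>
        simp only [Function.comp, Fin.snoc_castSucc, Fin.snoc_last, rightExt_castSucc, rightExt_last, Fin.lt_succAbove_iff_le_castSucc]
        have := hi a a.2
        rw [Fin.le_def, Fin.val_castSucc, hs]; exact this
    | cast b =>
      induction a using Fin.lastCases with
      | last => exact absurd hab (not_lt.mpr (Fin.le_last _))
      | cast a =>
        simp only [Function.comp, Fin.snoc_castSucc, rightExt_castSucc, Fin.succAbove_lt_succAbove_iff]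
        rw [Fin.lt_def, hs, hs]
        exact (hm a b (by simpa using hab) b.2).2

theorem hasIncr_inv {k n : ℕ} {σ τ : Fin n → Fin n} (h : ∀ x, τ (σ x) = x) (hi : HasIncr k n σ) :
    HasIncr k n τ := by
  obtain ⟨f, hf, hσ⟩ := hi
  exact ⟨σ ∘ f, hσ, fun a b hab => by simpa [Function.comp, h] using hf hab⟩

theorem hasDecr_inv {k n : ℕ} {σ τ : Fin n → Fin n} (h : ∀ x, τ (σ x) = x) (hi : HasDecr k n σ) :
    HasDecr k n τ := by
  obtain ⟨f, hf, hσ⟩ := hi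
  refine ⟨fun j => σ (f j.rev), fun a b hab => hσ (Fin.rev_lt_rev.mpr hab), fun a b hab => ?_⟩
  simpa [Function.comp, h] using hf (Fin.rev_lt_rev.mpr hab)

theorem contains_inv {k l n : ℕ} {σ τ : Fin n → Fin n} (h : ∀ x, τ (σ x) = x) (h' : ∀ x, σ (τ x) = x) :
    ContainsPat k l n σ ↔ ContainsPat k l n τ :=
  or_congr ⟨hasIncr_inv h, hasIncr_inv h'⟩ ⟨hasDecr_inv h, hasDecr_inv h'⟩

theorem avoids_inv {k l n : ℕ} {σ τ : Fin n → Fin n} (h : ∀ x, τ (σ x) = x) (h' : ∀ x, σ (τ x) = x) :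
    AvoidsPat k l n σ ↔ AvoidsPat k l n τ :=
  and_congr (not_congr ⟨hasIncr_inv h, hasIncr_inv h'⟩) (not_congr ⟨hasDecr_inv h, hasDecr_inv h'⟩)

theorem top_iff {k l n : ℕ} (σ : Equiv.Perm (Fin n)) (i : Fin (n+1)) :
    ContainsPat k l (n+1) (topExt σ i) ↔ ContainsPat k l (n+1) (rightExt (σ⁻¹ : Equiv.Perm (Fin n)) i) := by
  apply contains_inv
  · intro x
    rcases Fin.eq_self_or_eq_succAbove i x with rfl | ⟨y, rfl⟩
    · simp [topExt, rightExt_last]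
    · simp [topExt, rightExt_castSucc]
  · intro x
    induction x using Fin.lastCases with
    | last => simp [topExt, rightExt_last]
    | cast x => simp [topExt, rightExt_castSucc]

theorem trc_iff {k l n : ℕ} (σ : Equiv.Perm (Fin n)) :
    TopRightCrucial k l n σ ↔ RightCrucial k l n σ ∧ RightCrucial k l n (σ⁻¹ : Equiv.Perm (Fin n)) := by
  have h : AvoidsPat k l n σ ↔ AvoidsPat k l n (σ⁻¹ : Equiv.Perm (Fin n)) := avoids_inv (by simp) (by simp)
  unfold TopRightCrucial RightCrucial
  simp only [top_iff, ← h]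
  tauto

theorem not_incr_of_col {m n : ℕ} {σ : Fin n → Fin n} (c : ℕ → ℕ) (hc : ∀ i < n, c i ≤ m)
    (h : ∀ i j : Fin n, i < j → c i = c j → σ j < σ i) : ¬ HasIncr (m + 2) n σ := by
  rintro ⟨f, hf, hσ⟩
  obtain ⟨a, b, hab, he⟩ := Fintype.exists_ne_map_eq_of_card_lt
    (fun j : Fin (m+2) => (⟨c (f j), Nat.lt_succ_of_le (hc _ (f j).2)⟩ : Fin (m+1))) (by simp)
  simp only [Fin.mk.injEq] at he
  rcases lt_or_gt_of_ne hab with h1 | h1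
  · exact absurd (hσ h1) (not_lt.mpr (h _ _ (hf h1) he).le)
  · exact absurd (hσ h1) (not_lt.mpr (h _ _ (hf h1) he.symm).le)

theorem not_decr_of_col {m n : ℕ} {σ : Fin n → Fin n} (c : ℕ → ℕ) (hc : ∀ i < n, c i ≤ m)
    (h : ∀ i j : Fin n, i < j → c i = c j → σ i < σ j) : ¬ HasDecr (m + 2) n σ := by
  rintro ⟨f, hf, hσ⟩
  obtain ⟨a, b, hab, he⟩ := Fintype.exists_ne_map_eq_of_card_lt
    (fun j : Fin (m+2) => (⟨c (f j), Nat.lt_succ_of_le (hc _ (f j).2)⟩ : Fin (m+1))) (by simp)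
  simp only [Fin.mk.injEq] at he
  rcases lt_or_gt_of_ne hab with h1 | h1
  · exact absurd (hσ h1) (not_lt.mpr (h _ _ (hf h1) he).le)
  · exact absurd (hσ h1) (not_lt.mpr (h _ _ (hf h1) he.symm).le)

theorem perm_eq {n : ℕ} (σ τ : Equiv.Perm (Fin n)) (R : Fin n → Prop)
    (h1 : ∀ i, ¬ R i → σ i = τ i)
    (h2 : ∀ i j, R i → R j → i < j → (σ i < σ j ↔ τ i < τ j)) : σ = τ := by
  have h2' : ∀ i j, R i → R j → (σ i < σ j ↔ τ i < τ j) := by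
    intro i j hi hj
    rcases lt_trichotomy i j with h | rfl | h
    · exact h2 i j hi hj h
    · simp
    · have a := h2 j i hj hi h
      have b : σ i ≠ σ j := fun e => h.ne' (σ.injective e)
      have c : τ i ≠ τ j := fun e => h.ne' (τ.injective e)
      have d : σ i < σ j ↔ ¬ σ j < σ i := ⟨fun x => not_lt.mpr x.le, fun x => lt_of_le_of_ne (not_lt.mp x) b⟩
      have e : τ i < τ j ↔ ¬ τ j < τ i := ⟨fun x => not_lt.mpr x.le, fun x => lt_of_le_of_ne (not_lt.mp x) c⟩
      rw [d, e, a]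
  -- minimal value where the inverses differ
  have key : ∀ a : Fin n, τ (σ.symm a) = a := by
    intro a
    induction a using WellFoundedLT.induction with
    | ind a ih =>
      by_contra hne
      have hR : R (σ.symm a) := by
        by_contra h
        have := h1 _ h
        rw [Equiv.apply_symm_apply] at this
        exact hne this.symm
      have hgt : a < τ (σ.symm a) := by
        rcases lt_trichotomy (τ (σ.symm a)) a with h | h | h
        · have := ih _ h
          have := τ.injective this
          have h3 := σ.symm.injective this
          exact absurd h3 hne
        · exact absurd h hne
        · exact h
      have hR' : R (τ.symm a) := by
        by_contra h
        have h3 := h1 _ h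
        rw [Equiv.apply_symm_apply] at h3
        apply hne
        have : σ.symm a = τ.symm a := by rw [Equiv.symm_apply_eq]; exact h3.symm
        rw [this]; simp
      have h4 := (h2' (τ.symm a) (σ.symm a) hR' hR).mpr (by simpa using hgt)
      rw [Equiv.apply_symm_apply] at h4
      have h5 := ih _ h4
      simp only [Equiv.symm_apply_apply, Equiv.apply_symm_apply] at h5
      rw [← h5] at h4
      exact lt_irrefl _ h4
  ext x
  have := key (σ x)
  simp only [Equiv.symm_apply_apply] at this
  rw [this]

theorem extract (K L n : ℕ) (hn : n = K + L + 2) (σ : Equiv.Perm (Fin n)) (s : ℕ → ℕ)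
    (hs : ∀ x : Fin n, (σ x).val = s x.val) (h : RightCrucial (K+2) (L+2) n σ) :
    ∃ c e, RR K n s c e := by
  classical
  obtain ⟨⟨hI, hD⟩, hext⟩ := h
  let P : ℕ → Prop := fun i => ∃ S : Finset (Fin n), S.card = K + 1 ∧
    (∀ a ∈ S, ∀ b ∈ S, a < b → σ a < σ b) ∧ ∀ a ∈ S, (σ a).val < i
  have hPQ : ∀ i ≤ n, P i ∨ ∃ S : Finset (Fin n), S.card = L + 1 ∧
    (∀ a ∈ S, ∀ b ∈ S, a < b → σ b < σ a) ∧ ∀ a ∈ S, i ≤ (σ a).val := by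
    intro i hi
    rcases hext ⟨i, by omega⟩ with h | h
    · exact Or.inl (incr_of_ext h hI)
    · exact Or.inr (decr_of_ext h hD)
  have hex : ∃ i, P i := by
    refine ⟨n, ?_⟩
    rcases hPQ n le_rfl with h | ⟨S, h1, h2, h3⟩
    · exact h
    · obtain ⟨x, hx⟩ : S.Nonempty := Finset.card_pos.mp (by omega)
      have := h3 x hx
      have := (σ x).2
      omega
  obtain ⟨c, hPc, hnP⟩ : ∃ c, P (c+1) ∧ ¬ P c := by
    have h1 := Nat.find_spec hex
    have h0 : Nat.find hex ≠ 0 := by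
      intro h0
      rw [h0] at h1
      obtain ⟨S, a, b, d⟩ := h1
      obtain ⟨x, hx⟩ : S.Nonempty := Finset.card_pos.mp (by omega)
      have := d x hx
      omega
    refine ⟨Nat.find hex - 1, ?_, Nat.find_min hex (by omega)⟩
    rwa [Nat.sub_add_cancel (by omega)]
  obtain ⟨SI, cI, mI, bI⟩ := hPc
  have hcn : c ≤ n := by
    by_contra hcon
    exact hnP ⟨SI, cI, mI, fun a ha => by have := (σ a).2; omega⟩
  obtain ⟨SD, cD, mD, bD⟩ := (hPQ c hcn).resolve_left hnP
  let z : Fin n := ⟨n - 1, by omega⟩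
  have zmax : ∀ x : Fin n, x ≤ z := fun x => by rw [Fin.le_def]; have := x.2; simp only [z]; omega
  -- adding z to an increasing set
  have addI : ∀ S : Finset (Fin n), S.card = K + 1 → (∀ a ∈ S, ∀ b ∈ S, a < b → σ a < σ b) → z ∉ S →
      (∀ a ∈ S, (σ a).val < (σ z).val) → False := by
    intro S h1 h2 h3 h4
    apply hI
    refine hasIncr_of_set (insert z S) (by rw [Finset.card_insert_of_notMem h3, h1]) ?_
    intro a ha b hb hab
    rw [Finset.mem_insert] at ha hb
    rcases ha with rfl | ha
    · exact absurd hab (not_lt.mpr (zmax b))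
    · rcases hb with rfl | hb
      · exact h4 a ha
      · exact h2 a ha b hb hab
  have addD : ∀ S : Finset (Fin n), S.card = L + 1 → (∀ a ∈ S, ∀ b ∈ S, a < b → σ b < σ a) → z ∉ S →
      (∀ a ∈ S, (σ z).val < (σ a).val) → False := by
    intro S h1 h2 h3 h4
    apply hD
    refine hasDecr_of_set (insert z S) (by rw [Finset.card_insert_of_notMem h3, h1]) ?_
    intro a ha b hb hab
    rw [Finset.mem_insert] at ha hb
    rcases ha with rfl | ha
    · exact absurd hab (not_lt.mpr (zmax b))
    · rcases hb with rfl | hb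
      · exact h4 a ha
      · exact h2 a ha b hb hab
  have inj : ∀ a b : Fin n, (σ a).val = (σ b).val → a = b := fun a b h => σ.injective (Fin.ext h)
  have z1 : (σ z).val ≤ c := by
    by_contra hc
    exact addI SI cI mI (fun h => by have := bI z h; omega) (fun a ha => by have := bI a ha; omega)
  have z2 : c ≤ (σ z).val := by
    by_contra hc
    exact addD SD cD mD (fun h => by have := bD z h; omega) (fun a ha => by have := bD a ha; omega)
  have hzc : (σ z).val = c := le_antisymm z1 z2
  have zI : z ∈ SI := by
    by_contra hz
    refine addI SI cI mI hz (fun a ha => ?_)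
    have := bI a ha
    have : (σ a).val ≠ (σ z).val := fun h => hz (inj _ _ h ▸ ha)
    omega
  have zD : z ∈ SD := by
    by_contra hz
    refine addD SD cD mD hz (fun a ha => ?_)
    have := bD a ha
    have : (σ a).val ≠ (σ z).val := fun h => hz (inj _ _ h ▸ ha)
    omega
  have hinter : SI ∩ SD = {z} := by
    ext x
    simp only [Finset.mem_inter, Finset.mem_singleton]
    constructor
    · rintro ⟨h1, h2⟩
      have := bI x h1
      have := bD x h2
      exact inj _ _ (by omega)
    · rintro rfl; exact ⟨zI, zD⟩
  have hcardU : (SI ∪ SD).card = n - 1 := by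
    have := Finset.card_union_add_card_inter SI SD
    rw [hinter, Finset.card_singleton] at this
    omega
  have hcompl : ((SI ∪ SD)ᶜ).card = 1 := by
    rw [Finset.card_compl, hcardU, Fintype.card_fin]; omega
  obtain ⟨e, he⟩ := Finset.card_eq_one.mp hcompl
  have hmem : ∀ x, x ≠ e → x ∈ SI ∨ x ∈ SD := by
    intro x hx
    by_contra h
    apply hx
    rw [← Finset.mem_singleton, ← he]
    simpa using h
  have heI : e ∉ SI ∧ e ∉ SD := by
    have : e ∈ (SI ∪ SD)ᶜ := by rw [he]; simp
    simpa using this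
  have hez : e ≠ z := fun h => heI.1 (h ▸ zI)
  have hec : (σ e).val ≠ c := fun h => hez (inj _ _ (by omega))
  have lowI : ∀ x, x ≠ e → (σ x).val < c → x ∈ SI := by
    intro x hx h
    rcases hmem x hx with h1 | h1
    · exact h1
    · have := bD x h1; omega
  have upD : ∀ x, x ≠ e → c < (σ x).val → x ∈ SD := by
    intro x hx h
    rcases hmem x hx with h1 | h1
    · have := bI x h1; omega
    · exact h1
  have hclt : c < n := by have := (σ z).2; omega
  have hcardlow : (Finset.univ.filter (fun x : Fin n => (σ x).val < c)).card = c := by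
    have : (Finset.univ.filter (fun x : Fin n => (σ x).val < c)) = (Finset.univ.filter (fun x : Fin n => x.val < c)).map σ.symm.toEmbedding := by
      ext x
      simp only [Finset.mem_filter, Finset.mem_univ, true_and, Finset.mem_map, Equiv.coe_toEmbedding]
      constructor
      · intro h; exact ⟨σ x, h, by simp⟩
      · rintro ⟨y, hy, rfl⟩; simpa using hy
    rw [this, Finset.card_map, Fin.card_filter_val_lt]
    omega
  have cIe : (SI.erase z).card = K := by rw [Finset.card_erase_of_mem zI, cI]; rfl
  have cDe : (SD.erase z).card = L := by rw [Finset.card_erase_of_mem zD, cD]; rfl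
  have lowset : ∀ x, x ≠ e → ((σ x).val < c ↔ x ∈ SI.erase z) := by
    intro x hx
    rw [Finset.mem_erase]
    constructor
    · intro h
      exact ⟨fun h' => by rw [h'] at h; omega, lowI x hx h⟩
    · rintro ⟨h1, h2⟩
      have := bI x h2
      have : (σ x).val ≠ (σ z).val := fun h => h1 (inj _ _ h)
      omega
  have upset : ∀ x, x ≠ e → (c < (σ x).val ↔ x ∈ SD.erase z) := by
    intro x hx
    rw [Finset.mem_erase]
    constructor
    · intro h
      exact ⟨fun h' => by rw [h'] at h; omega, upD x hx h⟩
    · rintro ⟨h1, h2⟩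
      have := bD x h2
      have : (σ x).val ≠ (σ z).val := fun h => h1 (inj _ _ h)
      omega
  have heI' : e ∉ SI.erase z := fun h => heI.1 (Finset.mem_of_mem_erase h)
  have heD' : e ∉ SD.erase z := fun h => heI.2 (Finset.mem_of_mem_erase h)
  have hcase : (c = K ∧ K < (σ e).val) ∨ (c = K + 1 ∧ (σ e).val < K + 1) := by
    rcases lt_or_gt_of_ne hec with h | h
    · right
      have : (Finset.univ.filter (fun x : Fin n => (σ x).val < c)) = insert e (SI.erase z) := by
        ext x
        simp only [Finset.mem_filter, Finset.mem_univ, true_and, Finset.mem_insert]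
        by_cases hx : x = e
        · subst hx; simp [h]
        · rw [lowset x hx]; simp [hx]
      rw [this, Finset.card_insert_of_notMem heI', cIe] at hcardlow
      omega
    · left
      have : (Finset.univ.filter (fun x : Fin n => (σ x).val < c)) = SI.erase z := by
        ext x
        simp only [Finset.mem_filter, Finset.mem_univ, true_and]
        by_cases hx : x = e
        · subst hx
          constructor
          · intro h'; omega
          · intro h'; exact absurd h' heI'
        · rw [lowset x hx]
      rw [this, cIe] at hcardlow
      omega
  have hv : ∀ i (hi : i < n), s i = (σ ⟨i, hi⟩).val := fun i hi => (hs ⟨i, hi⟩).symm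
  have hse := hs e
  have hez' : e.val ≠ n - 1 := fun h => hez (Fin.ext h)
  have hen := e.2
  refine ⟨c, e.val, ?_, by omega, ?_, ?_, ?_, ?_, ?_⟩
  · rw [← hzc]; exact (hs z).symm
  · rw [← hse]; exact hcase
  · intro i j hij hj hie hje hi1 hj1
    rw [hv i (by omega)] at hi1 ⊢
    rw [hv j (by omega)] at hj1 ⊢
    exact mI _ (lowI _ (fun h => hie (congrArg Fin.val h)) hi1) _ (lowI _ (fun h => hje (congrArg Fin.val h)) hj1) hij
  · intro i j hij hj hie hje hi1 hj1
    rw [hv i (by omega)] at hi1 ⊢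
    rw [hv j (by omega)] at hj1 ⊢
    exact mD _ (upD _ (fun h => hie (congrArg Fin.val h)) hi1) _ (upD _ (fun h => hje (congrArg Fin.val h)) hj1) hij
  · intro hcK
    by_contra hno
    push Not at hno
    have hup : c < (σ e).val := by omega
    have hall : ∀ x ∈ insert e (SD.erase z), c < (σ x).val := by
      intro x hx
      rcases Finset.mem_insert.mp hx with rfl | hx
      · exact hup
      · exact (upset x (fun h => heD' (h ▸ hx))).mpr hx
    refine addD (insert e (SD.erase z)) (by rw [Finset.card_insert_of_notMem heD', cDe]) ?_ ?_ ?_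
    · intro a ha b hb hab
      have hbz : b.val ≠ n - 1 := fun h => by
        have h1 := hall b hb
        have : b = z := Fin.ext h
        rw [this] at h1; omega
      have hbn := b.2
      have a1 := hall a ha
      have := hno a.val b.val hab (by omega) (by rw [← hs]; exact a1)
      rw [← hs, ← hs] at this
      have hne : (σ a).val ≠ (σ b).val := fun h => hab.ne (inj _ _ h)
      rw [Fin.lt_def]; omega
    · intro h; have := hall z h; omega
    · intro a ha; have := hall a ha; omega
  · intro hcK
    by_contra hno
    push Not at hno
    have hup : (σ e).val < c := by omega
    have hall : ∀ x ∈ insert e (SI.erase z), (σ x).val < c := by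
      intro x hx
      rcases Finset.mem_insert.mp hx with rfl | hx
      · exact hup
      · exact (lowset x (fun h => heI' (h ▸ hx))).mpr hx
    refine addI (insert e (SI.erase z)) (by rw [Finset.card_insert_of_notMem heI', cIe]) ?_ ?_ ?_
    · intro a ha b hb hab
      have hbz : b.val ≠ n - 1 := fun h => by
        have h1 := hall b hb
        have : b = z := Fin.ext h
        rw [this] at h1; omega
      have hbn := b.2
      have a1 := hall a ha
      have hne : (σ a).val ≠ (σ b).val := fun h => hab.ne (inj _ _ h)
      rw [Fin.lt_def]
      by_contra hlt
      have := hno a.val b.val hab (by omega) (by rw [← hs, ← hs]; omega)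
      rw [← hs] at this
      omega
    · intro h; have := hall z h; omega
    · intro a ha; have := hall a ha; omega

/-- the permutation attached to a pair -/
def FP (K L n : ℕ) (hn : n = K + L + 2) (hK : 1 ≤ K) (hL : 1 ≤ L) (t p v : ℕ)
    (ht : t < K) (hp : t < p) (hp' : p + 1 < n) (hv : t < v) (hv' : v + 1 < n) : Equiv.Perm (Fin n) where
  toFun i := ⟨ff K n t p v i, ff_lt K L n t p v hn hK hL ht hp hp' hv hv' i i.2⟩
  invFun i := ⟨ff K n t v p i, ff_lt K L n t v p hn hK hL ht hv hv' hp hp' i i.2⟩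
  left_inv i := Fin.ext (ff_inv K L n t p v hn hK hL ht hp hp' hv hv' i i.2)
  right_inv i := Fin.ext (ff_inv K L n t v p hn hK hL ht hv hv' hp hp' i i.2)

section FPs
variable (K L n : ℕ) (hn : n = K + L + 2) (hK : 1 ≤ K) (hL : 1 ≤ L) (t p v : ℕ)
    (ht : t < K) (hp : t < p) (hp' : p + 1 < n) (hv : t < v) (hv' : v + 1 < n)

theorem FP_inv : (FP K L n hn hK hL t p v ht hp hp' hv hv')⁻¹ = FP K L n hn hK hL t v p ht hv hv' hp hp' := rfl

theorem FP_rc (hcond : t + 1 = K ∨ v = t + 1 ∨ p = t + 1) :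
    RightCrucial (K+2) (L+2) n (FP K L n hn hK hL t p v ht hp hp' hv hv') := by
  refine ⟨⟨?_, ?_⟩, ?_⟩
  · apply not_incr_of_col (colA K t p)
    · intro i hi; unfold colA; split_ifs <;> omega
    · intro i j hij hc
      exact colA_spec K L n t p v hn hK hL ht hp hp' hv hv' i j hij j.2 hc
  · apply not_decr_of_col (colB K L t p)
    · intro i hi; unfold colB
      split_ifs with h1 h2
      · omega
      · omega
      · omega
      · omega
      · have := rk_lt t p n i hp (by omega) h1 h2 hi; omega
    · intro i j hij hc
      exact colB_spec K L n t p v hn hK hL ht hp hp' hv hv' hcond i j hij j.2 hc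
  · intro i
    by_cases hi : ff K n t p v (n - 1) < i.val
    · left
      obtain ⟨g, g1, g2, g3⟩ := exI K L n t p v hn hK hL ht hp hp' hv hv' hcond
      refine ext_incr g (ff K n t p v) (fun x => rfl) (fun a ha => g1 a (by omega))
        (fun a b hab hb => g3 a b hab (by omega)) ?_
      intro a ha
      rcases Nat.lt_or_ge a K with h | h
      · have := (g3 a K h le_rfl).2; rw [g2] at this; omega
      · have : a = K := by omega
        rw [this, g2]; exact hi
    · right
      obtain ⟨g, g1, g2, g3⟩ := exD K L n t p v hn hK hL ht hp hp' hv hv'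
      refine ext_decr g (ff K n t p v) (fun x => rfl) (fun a ha => g1 a (by omega))
        (fun a b hab hb => g3 a b hab (by omega)) ?_
      intro a ha
      rcases Nat.lt_or_ge a L with h | h
      · have := (g3 a L h le_rfl).2; rw [g2] at this; omega
      · have : a = L := by omega
        rw [this, g2]; omega

theorem FP_trc (hcond : t + 1 = K ∨ v = t + 1 ∨ p = t + 1) :
    TopRightCrucial (K+2) (L+2) n (FP K L n hn hK hL t p v ht hp hp' hv hv') := by
  rw [trc_iff, FP_inv]
  exact ⟨FP_rc _ _ _ _ _ _ _ _ _ _ _ _ _ _ hcond, FP_rc _ _ _ _ _ _ _ _ _ _ _ _ _ _ (by tauto)⟩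
end FPs

/-- target property -/
def IsF (K L n : ℕ) (hn : n = K + L + 2) (hK : 1 ≤ K) (hL : 1 ≤ L) (σ : Equiv.Perm (Fin n)) : Prop :=
  ∃ t p v ht hp hp' hv hv', (t + 1 = K ∨ v = t + 1 ∨ p = t + 1) ∧ σ = FP K L n hn hK hL t p v ht hp hp' hv hv'

theorem isF_inv {K L n hn hK hL σ} (h : IsF K L n hn hK hL σ⁻¹) : IsF K L n hn hK hL σ := by
  obtain ⟨t, p, v, ht, hp, hp', hv, hv', hc, he⟩ := h
  refine ⟨t, v, p, ht, hv, hv', hp, hp', by tauto, ?_⟩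
  rw [← inv_inv σ, he, FP_inv]

theorem isF_of_good (K L n : ℕ) (hn : n = K + L + 2) (hK : 1 ≤ K) (hL : 1 ≤ L) (σ : Equiv.Perm (Fin n)) (s : ℕ → ℕ)
    (hs : ∀ x : Fin n, (σ x).val = s x.val) (h : GoodP K n s) : IsF K L n hn hK hL σ := by
  obtain ⟨t, p, v, ht, hp, hp', hv, hv', hst, hsp, hc, hcmp⟩ := h
  refine ⟨t, p, v, ht, hp, hp', hv, hv', hc, ?_⟩
  apply perm_eq _ _ (fun i => i.val ≠ t ∧ i.val ≠ p)
  · intro i hi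
    apply Fin.ext
    rw [hs]
    change s i = ff K n t p v i
    by_cases h1 : i.val = t
    · rw [h1, hst, ff_t]
    · have h2 : i.val = p := by tauto
      rw [h2, hsp, ff_p _ _ _ _ _ hp]
  · rintro i j ⟨h1, h2⟩ ⟨h3, h4⟩ hij
    rw [Fin.lt_def, hs, hs, hcmp i j hij j.2 h1 h2 h3 h4]
    exact (ff_cmp K L n t p v hn hK hL ht hp hp' hv hv' i j hij j.2 h1 h2 h3 h4).symm

theorem isF_of_trc (K L n : ℕ) (hn : n = K + L + 2) (hK : 1 ≤ K) (hL : 1 ≤ L) (σ : Equiv.Perm (Fin n))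
    (h : TopRightCrucial (K+2) (L+2) n σ) : IsF K L n hn hK hL σ := by
  rw [trc_iff] at h
  obtain ⟨h1, h2⟩ := h
  let S : Equiv.Perm (Fin n) → ℕ → ℕ := fun τ i => if h : i < n then (τ ⟨i, h⟩).val else i
  have hS : ∀ (τ : Equiv.Perm (Fin n)) (x : Fin n), (τ x).val = S τ x.val := fun τ x => by simp [S]
  have lt : ∀ τ, ∀ i < n, S τ i < n := fun τ i hi => by simp [S, hi]
  have i1 : ∀ i < n, S σ⁻¹ (S σ i) = i := fun i hi => by
    have e1 := hS σ ⟨i, hi⟩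
    have e2 := hS σ⁻¹ (σ ⟨i, hi⟩)
    simp only at e1
    rw [← e1, ← e2]; simp
  have i2 : ∀ i < n, S σ (S σ⁻¹ i) = i := fun i hi => by
    have e1 := hS σ⁻¹ ⟨i, hi⟩
    have e2 := hS σ (σ⁻¹ ⟨i, hi⟩)
    simp only at e1
    rw [← e1, ← e2]; simp
  obtain ⟨c, e, r1⟩ := extract K L n hn σ (S σ) (hS σ) h1
  obtain ⟨d, e', r2⟩ := extract K L n hn σ⁻¹ (S σ⁻¹) (hS σ⁻¹) h2
  have hc : c = K ∨ c = K + 1 := by rcases r1.hc with h | h <;> simp [h.1]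
  have hd : d = K ∨ d = K + 1 := by rcases r2.hc with h | h <;> simp [h.1]
  rcases hc with hc | hc <;> rcases hd with hd | hd <;> rw [hc] at r1 <;> rw [hd] at r2
  · refine isF_of_good _ _ _ _ _ _ _ _ (hS σ) (case_a _ L n _ _ hn hK hL (lt _) (lt _) i1 i2 e e' r1 r2 ?_)
    intro i j hi hij hj hfix
    by_contra hlt
    apply h1.1.1
    have hne : S σ i ≠ S σ j := fun h => by
      have a := i1 i (by omega)
      rw [h, i1 j hj] at a; omega
    have hge : ∀ x < n, K ≤ x → K ≤ S σ x := by
      intro x hx hKx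
      by_contra hc
      have a := hfix (S σ x) (by omega)
      have b := i1 (S σ x) (lt _ _ hx)
      rw [a, i1 x hx] at b; omega
    let g : ℕ → ℕ := fun a => if a < K then a else if a = K then i else j
    have hg : ∀ a, g a < n := by
      intro a; simp only [g]; split_ifs <;> omega
    have hgi := hge i (by omega) hi
    have hgj := hge j (by omega) (by omega)
    refine ⟨fun a => ⟨g a, hg a⟩, fun a b hab => ?_, fun a b hab => ?_⟩
    · have := b.2
      rw [Fin.lt_def] at hab ⊢
      simp only [g]; split_ifs <;> omega
    · have := b.2
      rw [Fin.lt_def] at hab ⊢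
      simp only [Function.comp, hS]
      have h1 := hfix a.val
      have h2 := hfix b.val
      simp only [g]; split_ifs <;> omega
  · exact isF_of_good _ _ _ _ _ _ _ _ (hS σ) (case_b _ L n _ _ hn hK hL (lt _) (lt _) i1 i2 e e' r1 r2)
  · exact isF_inv (isF_of_good _ _ _ _ _ _ _ _ (hS σ⁻¹) (case_b _ L n _ _ hn hK hL (lt _) (lt _) i2 i1 e' e r2 r1))
  · exact isF_of_good _ _ _ _ _ _ _ _ (hS σ) (case_d _ L n _ _ hn hK hL (lt _) (lt _) i1 i2 e e' r1 r2)

theorem FP_inj (K L n : ℕ) (hn : n = K + L + 2) (hK : 1 ≤ K) (hL : 1 ≤ L) {t p v ht hp hp' hv hv' t₂ p₂ v₂ ht₂ hp₂ hp₂' hv₂ hv₂'}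
    (h : FP K L n hn hK hL t p v ht hp hp' hv hv' = FP K L n hn hK hL t₂ p₂ v₂ ht₂ hp₂ hp₂' hv₂ hv₂') :
    p = p₂ ∧ v = v₂ := by
  have e : ∀ i < n, ff K n t p v i = ff K n t₂ p₂ v₂ i := fun i hi =>
    congrArg Fin.val (DFunLike.congr_fun h (⟨i, hi⟩ : Fin n))
  have e1 := ff_t K n t p v
  have e2 := ff_t K n t₂ p₂ v₂
  have f1 := ff_fix K L n t p v hn hK hL ht hp hp' hv hv' t₂
  have f2 := ff_fix K L n t₂ p₂ v₂ hn hK hL ht₂ hp₂ hp₂' hv₂ hv₂' t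
  have g1 := e t (by omega)
  have g2 := e t₂ (by omega)
  have ht : t = t₂ := by omega
  subst ht
  refine ⟨?_, by omega⟩
  have a1 := ff_p K n t p v hp
  have a2 := ff_p K n t p₂ v₂ hp₂
  have a3 := e p (by omega)
  exact ff_inj K L n t p₂ v₂ hn hK hL ht₂ hp₂ hp₂' hv₂ hv₂' p p₂ (by omega) (by omega) (by omega)

theorem core (K L n : ℕ) (hn : n = K + L + 2) (hK : 1 ≤ K) (hL : 1 ≤ L) :
    Nat.card {σ : Equiv.Perm (Fin n) // TopRightCrucial (K+2) (L+2) n ⇑σ} = (K + L) ^ 2 := by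
  let G : Fin (K+L) × Fin (K+L) → {σ : Equiv.Perm (Fin n) // TopRightCrucial (K+2) (L+2) n ⇑σ} := fun x =>
    ⟨FP K L n hn hK hL (min (min x.1.val x.2.val) (K-1)) (x.1.val+1) (x.2.val+1)
      (by omega) (by omega) (by omega) (by omega) (by omega), FP_trc _ _ _ _ _ _ _ _ _ _ _ _ _ _ (by omega)⟩
  have hG : Function.Bijective G := by
    constructor
    · rintro ⟨a, b⟩ ⟨c, d⟩ h
      have h' := Subtype.mk.inj h
      have := FP_inj K L n hn hK hL h'
      simp only at this
      exact Prod.ext (Fin.ext (by simp only; omega)) (Fin.ext (by simp only; omega))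
    · rintro ⟨σ, hσ⟩
      obtain ⟨t, p, v, ht, hp, hp', hv, hv', hc, he⟩ := isF_of_trc K L n hn hK hL σ hσ
      refine ⟨(⟨p-1, by omega⟩, ⟨v-1, by omega⟩), Subtype.ext ?_⟩
      simp only [G]
      rw [he]
      congr 1 <;> omega
  rw [← Nat.card_congr (Equiv.ofBijective G hG)]
  simp [sq]

theorem count_next_minimal_topRightCrucial (k l : ℕ) (hk : 3 ≤ k) (hl : 3 ≤ l) :
    Nat.card {σ : Equiv.Perm (Fin (k + l - 2)) // TopRightCrucial k l (k + l - 2) ⇑σ} =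
      (k + l - 4) ^ 2 := by
  obtain ⟨K, rfl⟩ : ∃ K, k = K + 2 := ⟨k - 2, by omega⟩
  obtain ⟨L, rfl⟩ : ∃ L, l = L + 2 := ⟨l - 2, by omega⟩
  rw [core K L _ (by omega) (by omega) (by omega)]
  congr 1
  omega
end

section
/- Let k ≥ 3. The minimal possible length of a (k,3)-tricrucial permutation is k+1, and the number of (k,3)-tricrucial permutations of length k+1 equals k−1 if k > 3, and equals 4 if k = 3. -/
set_option linter.unusedSimpArgs false

theorem hasIncr_iff (k n : ℕ) (σ : Fin n → Fin n) :
    HasIncr k n σ ↔ ∃ S : Finset (Fin n), k ≤ S.card ∧ StrictMonoOn σ (S : Set (Fin n)) := by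
  constructor
  · rintro ⟨f, hf, hg⟩
    refine ⟨Finset.univ.image f, ?_, ?_⟩
    · rw [Finset.card_image_of_injective _ hf.injective]; simp
    · intro x hx y hy hxy
      simp only [Finset.coe_image, Finset.coe_univ, Set.image_univ, Set.mem_range] at hx hy
      obtain ⟨a, rfl⟩ := hx
      obtain ⟨b, rfl⟩ := hy
      exact hg (hf.lt_iff_lt.1 hxy)
  · rintro ⟨S, hS, hm⟩
    obtain ⟨T, hT, hc⟩ := Finset.exists_subset_card_eq hS
    refine ⟨T.orderEmbOfFin hc, (T.orderEmbOfFin hc).strictMono, ?_⟩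
    intro a b hab
    exact hm (hT (T.orderEmbOfFin_mem hc a)) (hT (T.orderEmbOfFin_mem hc b))
      ((T.orderEmbOfFin hc).strictMono hab)

theorem hasDecr_iff (n : ℕ) (σ : Fin n → Fin n) :
    HasDecr 3 n σ ↔ ∃ x y z : Fin n, x < y ∧ y < z ∧ σ y < σ x ∧ σ z < σ y := by
  constructor
  · rintro ⟨f, hf, hg⟩
    exact ⟨f 0, f 1, f 2, hf (by decide), hf (by decide), hg (by decide), hg (by decide)⟩
  · rintro ⟨x, y, z, h1, h2, h3, h4⟩
    refine ⟨![x, y, z], ?_, ?_⟩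
    · rw [Fin.strictMono_iff_lt_succ]
      intro i
      fin_cases i <;> simpa
    · rw [Fin.strictAnti_iff_succ_lt]
      intro i
      fin_cases i <;> simpa

theorem hasIncr3_iff (n : ℕ) (σ : Fin n → Fin n) :
    HasIncr 3 n σ ↔ ∃ x y z : Fin n, x < y ∧ y < z ∧ σ x < σ y ∧ σ y < σ z := by
  constructor
  · rintro ⟨f, hf, hg⟩
    exact ⟨f 0, f 1, f 2, hf (by decide), hf (by decide), hg (by decide), hg (by decide)⟩
  · rintro ⟨x, y, z, h1, h2, h3, h4⟩
    refine ⟨![x, y, z], ?_, ?_⟩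
    · rw [Fin.strictMono_iff_lt_succ]
      intro i
      fin_cases i <;> simpa
    · rw [Fin.strictMono_iff_lt_succ]
      intro i
      fin_cases i <;> simpa

theorem sa_lt_iff {n : ℕ} (p : Fin (n + 1)) (x : Fin n) :
    p.succAbove x < p ↔ (x : ℕ) < p := by
  rw [Fin.succAbove_lt_iff_castSucc_lt, Fin.lt_def]; simp

theorem lt_sa_iff {n : ℕ} (p : Fin (n + 1)) (x : Fin n) :
    p < p.succAbove x ↔ (p : ℕ) ≤ x := by
  rw [Fin.lt_succAbove_iff_le_castSucc, Fin.le_def]; simp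

theorem ext_iff {n k : ℕ} (σ : Fin n → Fin n) (hav : AvoidsPat k 3 n σ) (p v : Fin (n + 1))
    (g : Fin (n + 1) → Fin (n + 1)) (hp : g p = v)
    (hg : ∀ x, g (p.succAbove x) = v.succAbove (σ x)) :
    ContainsPat k 3 (n + 1) g ↔
      (∃ S : Finset (Fin n), k ≤ S.card + 1 ∧ StrictMonoOn σ (S : Set (Fin n)) ∧
        ∀ x ∈ S, ((x : ℕ) < p ↔ (σ x : ℕ) < v)) ∨
      (∃ x y : Fin n, x < y ∧ σ y < σ x ∧ ((x : ℕ) < p ↔ (v : ℕ) ≤ σ x) ∧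
        ((y : ℕ) < p ↔ (v : ℕ) ≤ σ y)) := by
  obtain ⟨h1, h2⟩ := hav
  rw [hasIncr_iff] at h1
  rw [hasDecr_iff] at h2
  unfold ContainsPat
  rw [hasIncr_iff, hasDecr_iff]
  refine or_congr ⟨?_, ?_⟩ ⟨?_, ?_⟩
  · rintro ⟨S, hS, hm⟩
    have hmono : StrictMonoOn σ
        ((Finset.univ.filter (fun x => p.succAbove x ∈ S) : Finset (Fin n)) : Set (Fin n)) := by
      intro x hx y hy hxy
      simp only [Finset.coe_filter, Finset.mem_univ, true_and, Set.mem_ofPred_eq] at hx hy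
      have := hm hx hy ((Fin.strictMono_succAbove p) hxy)
      rw [hg, hg] at this
      exact (Fin.strictMono_succAbove v).lt_iff_lt.1 this
    have hsub : S.erase p ⊆ (Finset.univ.filter (fun x => p.succAbove x ∈ S)).image p.succAbove := by
      intro x hx
      rw [Finset.mem_erase] at hx
      obtain ⟨y, rfl⟩ := Fin.exists_succAbove_eq hx.1
      exact Finset.mem_image_of_mem _ (by simpa using hx.2)
    have hc := (Finset.card_le_card hsub).trans Finset.card_image_le
    by_cases hpS : p ∈ S
    · refine ⟨_, ?_, hmono, ?_⟩
      · have := Finset.card_erase_add_one hpS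
        omega
      · intro x hx
        have hx : p.succAbove x ∈ S := by simpa using hx
        have := hm.lt_iff_lt hx hpS
        rw [hg, hp, sa_lt_iff, sa_lt_iff] at this
        exact this.symm
    · rw [Finset.erase_eq_of_notMem hpS] at hc
      exact absurd ⟨_, hS.trans hc, hmono⟩ h1
  · rintro ⟨S, hS, hm, hx⟩
    refine ⟨insert p (S.image p.succAbove), ?_, ?_⟩
    · rw [Finset.card_insert_of_notMem, Finset.card_image_of_injective _ Fin.succAbove_right_injective]
      · exact hS
      · simp [Fin.succAbove_ne]
    · intro a ha b hb hab
      simp only [Finset.coe_insert, Finset.coe_image, Set.mem_insert_iff, Set.mem_image,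
        Finset.mem_coe] at ha hb
      rcases ha with rfl | ⟨x, hxS, rfl⟩ <;> rcases hb with rfl | ⟨y, hyS, rfl⟩
      · exact absurd hab (lt_irrefl _)
      · rw [hp, hg, lt_sa_iff]; rw [lt_sa_iff] at hab
        have := hx y hyS
        omega
      · rw [hp, hg, sa_lt_iff]; rw [sa_lt_iff] at hab
        exact (hx x hxS).1 hab
      · rw [hg, hg]
        exact Fin.strictMono_succAbove v (hm hxS hyS ((Fin.strictMono_succAbove p).lt_iff_lt.1 hab))
  · have e1 := fun x y => (Fin.strictMono_succAbove p).lt_iff_lt (a := x) (b := y)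
    have e2 := fun x y => (Fin.strictMono_succAbove v).lt_iff_lt (a := x) (b := y)
    rintro ⟨a, b, c, hab, hbc, hba, hcb⟩
    have cs : a = p ∧ b ≠ p ∧ c ≠ p ∨ b = p ∧ a ≠ p ∧ c ≠ p ∨ c = p ∧ a ≠ p ∧ b ≠ p ∨
        a ≠ p ∧ b ≠ p ∧ c ≠ p := by omega
    rcases cs with ⟨rfl, hb, hc⟩ | ⟨rfl, ha, hc⟩ | ⟨rfl, ha, hb⟩ | ⟨ha, hb, hc⟩
    · obtain ⟨b, rfl⟩ := Fin.exists_succAbove_eq hb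
      obtain ⟨c, rfl⟩ := Fin.exists_succAbove_eq hc
      simp only [hp, hg, e1, e2, sa_lt_iff, lt_sa_iff] at hab hbc hba hcb
      exact ⟨b, c, hbc, hcb, by omega, by omega⟩
    · obtain ⟨a, rfl⟩ := Fin.exists_succAbove_eq ha
      obtain ⟨c, rfl⟩ := Fin.exists_succAbove_eq hc
      simp only [hp, hg, e1, e2, sa_lt_iff, lt_sa_iff] at hab hbc hba hcb
      exact ⟨a, c, by omega, by omega, by omega, by omega⟩
    · obtain ⟨a, rfl⟩ := Fin.exists_succAbove_eq ha
      obtain ⟨b, rfl⟩ := Fin.exists_succAbove_eq hb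
      simp only [hp, hg, e1, e2, sa_lt_iff, lt_sa_iff] at hab hbc hba hcb
      exact ⟨a, b, by omega, by omega, by omega, by omega⟩
    · obtain ⟨a, rfl⟩ := Fin.exists_succAbove_eq ha
      obtain ⟨b, rfl⟩ := Fin.exists_succAbove_eq hb
      obtain ⟨c, rfl⟩ := Fin.exists_succAbove_eq hc
      simp only [hp, hg, e1, e2, sa_lt_iff, lt_sa_iff] at hab hbc hba hcb
      exact absurd ⟨a, b, c, hab, hbc, hba, hcb⟩ h2
  · have e1 := fun x y => (Fin.strictMono_succAbove p).lt_iff_lt (a := x) (b := y)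
    have e2 := fun x y => (Fin.strictMono_succAbove v).lt_iff_lt (a := x) (b := y)
    rintro ⟨x, y, hxy, hs, hx, hy⟩
    by_cases h : (x : ℕ) < p
    · by_cases h' : (y : ℕ) < p
      · refine ⟨p.succAbove x, p.succAbove y, p, ?_⟩
        simp only [hp, hg, e1, e2, sa_lt_iff, lt_sa_iff]
        omega
      · refine ⟨p.succAbove x, p, p.succAbove y, ?_⟩
        simp only [hp, hg, e1, e2, sa_lt_iff, lt_sa_iff]
        omega
    · refine ⟨p, p.succAbove x, p.succAbove y, ?_⟩
      simp only [hp, hg, e1, e2, sa_lt_iff, lt_sa_iff]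
      omega

theorem tri_iff {n k : ℕ} (σ : Fin n → Fin n) :
    Tricrucial k 3 n σ ↔ AvoidsPat k 3 n σ ∧
      (∀ v : ℕ, v ≤ n → (∃ S : Finset (Fin n), k ≤ S.card + 1 ∧
          StrictMonoOn σ (S : Set (Fin n)) ∧ ∀ x ∈ S, (σ x : ℕ) < v) ∨
        (∃ x y : Fin n, x < y ∧ σ y < σ x ∧ v ≤ (σ y : ℕ))) ∧
      (∀ v : ℕ, v ≤ n → (∃ S : Finset (Fin n), k ≤ S.card + 1 ∧
          StrictMonoOn σ (S : Set (Fin n)) ∧ ∀ x ∈ S, v ≤ (σ x : ℕ)) ∨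
        (∃ x y : Fin n, x < y ∧ σ y < σ x ∧ (σ x : ℕ) < v)) ∧
      (∀ p : ℕ, p ≤ n → (∃ S : Finset (Fin n), k ≤ S.card + 1 ∧
          StrictMonoOn σ (S : Set (Fin n)) ∧ ∀ x ∈ S, (x : ℕ) < p) ∨
        (∃ x y : Fin n, x < y ∧ σ y < σ x ∧ p ≤ (x : ℕ))) := by
  have key : ∀ P : ℕ → Prop, (∀ v : ℕ, v ≤ n → P v) ↔ ∀ i : Fin (n + 1), P i := fun P =>
    ⟨fun h i => h i (by omega), fun h v hv => h ⟨v, by omega⟩⟩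
  have : Tricrucial k 3 n σ ↔ AvoidsPat k 3 n σ ∧
      (∀ i : Fin (n + 1), ContainsPat k 3 (n + 1) (rightExt σ i)) ∧
      (∀ i : Fin (n + 1), ContainsPat k 3 (n + 1) (leftExt σ i)) ∧
      (∀ i : Fin (n + 1), ContainsPat k 3 (n + 1) (topExt σ i)) := by
    unfold Tricrucial Bicrucial RightCrucial LeftCrucial
    tauto
  rw [this, key, key, key]
  refine and_congr_right fun hav => and_congr (forall_congr' fun i => ?_)
    (and_congr (forall_congr' fun i => ?_) (forall_congr' fun i => ?_))
  · rw [ext_iff σ hav (Fin.last n) i]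
    · refine or_congr (exists_congr fun S => and_congr_right fun _ => and_congr_right fun _ =>
        forall₂_congr fun x _ => ?_) (exists_congr fun x => exists_congr fun y =>
          and_congr_right fun h1 => and_congr_right fun h2 => ?_)
      · simp
      · simp; omega
    · simp [rightExt]
    · simp [rightExt]
  · rw [ext_iff σ hav 0 i]
    · refine or_congr (exists_congr fun S => and_congr_right fun _ => and_congr_right fun _ =>
        forall₂_congr fun x _ => ?_) (exists_congr fun x => exists_congr fun y =>
          and_congr_right fun h1 => and_congr_right fun h2 => ?_)
      · simp
      · simp; omega
    · simp [leftExt]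
    · simp [leftExt]
  · rw [ext_iff σ hav i (Fin.last n)]
    · refine or_congr (exists_congr fun S => and_congr_right fun _ => and_congr_right fun _ =>
        forall₂_congr fun x _ => ?_) (exists_congr fun x => exists_congr fun y =>
          and_congr_right fun h1 => and_congr_right fun h2 => ?_)
      · simp
      · simp; omega
    · simp [topExt]
    · simp [topExt]

theorem card_le_of_range {n : ℕ} (f : Fin n → Fin n) (hf : Function.Injective f)
    (S : Finset (Fin n)) (lo hi : ℕ) (h : ∀ x ∈ S, lo ≤ (f x : ℕ) ∧ (f x : ℕ) < hi) :
    S.card ≤ hi - lo := by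
  rw [← Nat.card_Ico]
  refine Finset.card_le_card_of_injOn (fun x => (f x : ℕ)) (fun x hx => ?_) ?_
  · simpa using h x hx
  · intro x _ y _ hxy
    exact hf (Fin.ext hxy)

theorem mem_of_full {n : ℕ} (f : Fin n → Fin n) (hf : Function.Injective f)
    (S : Finset (Fin n)) (lo hi : ℕ) (h : ∀ x ∈ S, lo ≤ (f x : ℕ) ∧ (f x : ℕ) < hi)
    (hc : hi - lo ≤ S.card) (x : Fin n) (h1 : lo ≤ (f x : ℕ)) (h2 : (f x : ℕ) < hi) : x ∈ S := by
  by_contra hx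
  have := card_le_of_range f hf (insert x S) lo hi (by
    intro y hy
    rcases Finset.mem_insert.1 hy with rfl | hy
    · exact ⟨h1, h2⟩
    · exact h y hy)
  rw [Finset.card_insert_of_notMem hx] at this
  omega

theorem mem_of_almost_full {n : ℕ} (f : Fin n → Fin n) (hf : Function.Injective f)
    (S : Finset (Fin n)) (lo hi : ℕ) (h : ∀ x ∈ S, lo ≤ (f x : ℕ) ∧ (f x : ℕ) < hi)
    (hc : hi - lo ≤ S.card + 1) (z : Fin n) (hz : z ∉ S) (hz1 : lo ≤ (f z : ℕ))
    (hz2 : (f z : ℕ) < hi) (x : Fin n) (hxz : x ≠ z)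
    (h1 : lo ≤ (f x : ℕ)) (h2 : (f x : ℕ) < hi) : x ∈ S := by
  have := mem_of_full f hf (insert z S) lo hi (by
    intro y hy
    rcases Finset.mem_insert.1 hy with rfl | hy
    · exact ⟨hz1, hz2⟩
    · exact h y hy) (by rw [Finset.card_insert_of_notMem hz]; exact hc) x h1 h2
  exact (Finset.mem_insert.1 this).resolve_left hxz

theorem lower_bound (k : ℕ) (hk : 3 ≤ k) (n : ℕ) (σ : Fin n → Fin n) (hb : Function.Bijective σ)
    (ht : Tricrucial k 3 n σ) : k + 1 ≤ n := by
  rw [tri_iff] at ht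
  obtain ⟨⟨hI, -⟩, hR, hL, -⟩ := ht
  rw [hasIncr_iff] at hI
  by_contra hn
  rcases Nat.eq_zero_or_pos n with h0 | h0
  · rcases hR 0 (by omega) with ⟨S, hS, -, -⟩ | ⟨x, -⟩
    · have := S.card_le_univ
      simp at this; omega
    · have := x.2
      omega
  rcases hL 1 (by omega) with ⟨S, hS, hm, hx⟩ | ⟨x, y, _, h, h'⟩
  swap
  · rw [Fin.lt_def] at h; omega
  have hS' := card_le_of_range σ hb.1 S 1 n (fun x h => ⟨hx x h, (σ x).2⟩)
  have hnk : n = k := by omega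
  subst hnk
  rcases hR (n - 1) (by omega) with ⟨T, hT, hmT, hxT⟩ | ⟨x, y, _, h, h'⟩
  swap
  · rw [Fin.lt_def] at h; omega
  have memS := mem_of_full σ hb.1 S 1 n (fun x h => ⟨hx x h, (σ x).2⟩) (by omega)
  have memT := mem_of_full σ hb.1 T 0 (n - 1) (fun x h => ⟨by omega, hxT x h⟩) (by omega)
  obtain ⟨w, hw⟩ := hb.2 ⟨1, by omega⟩
  have hw : (σ w : ℕ) = 1 := by rw [hw]
  refine hI ⟨Finset.univ, by simp, ?_⟩
  intro x _ y _ hxy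
  by_contra hc
  have hne : (σ x : ℕ) ≠ σ y := fun h => hxy.ne (hb.1 (Fin.ext h))
  have hS := fun a b ha hb => hm.lt_iff_lt (a := a) (b := b) ha hb
  have hT := fun a b ha hb => hmT.lt_iff_lt (a := a) (b := b) ha hb
  simp only [Finset.mem_coe, Fin.lt_def] at hS hT
  rw [Fin.lt_def] at hc hxy
  by_cases h1 : 1 ≤ (σ y : ℕ)
  · have := hS x y (memS x (by omega) (by omega)) (memS y (by omega) (by omega))
    omega
  by_cases h2 : (σ x : ℕ) < n - 1
  · have := hT x y (memT x (by omega) (by omega)) (memT y (by omega) (by omega))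
    omega
  have a1 := hS w x (memS w (by omega) (by omega)) (memS x (by omega) (by omega))
  have a2 := hT y w (memT y (by omega) (by omega)) (memT w (by omega) (by omega))
  omega

/-- The explicit shape of the minimal permutations. -/
def Shape (k : ℕ) (σ : Fin (k + 1) → Fin (k + 1)) : Prop :=
  (∀ x y, 1 ≤ (σ x : ℕ) → σ x < σ y → (σ x : ℕ) ≠ k - 1 → x < y) ∧
  (∀ x y, (σ x : ℕ) = k → (σ y : ℕ) = k - 1 → x < y) ∧
  (∀ x y, (σ x : ℕ) = 1 → (σ y : ℕ) = 0 → x < y) ∧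
  (∀ x y, (σ x : ℕ) = 0 → (σ y : ℕ) = k - 1 → x < y)

theorem shape_of_tri (k : ℕ) (hk : 4 ≤ k) (σ : Fin (k + 1) → Fin (k + 1))
    (hb : Function.Bijective σ) (ht : Tricrucial k 3 (k + 1) σ) : Shape k σ := by
  rw [tri_iff] at ht
  obtain ⟨⟨hI, hD⟩, hR, hL, hT⟩ := ht
  rw [hasIncr_iff] at hI
  rw [hasDecr_iff] at hD
  have sur : ∀ v : ℕ, v ≤ k → ∃ x, (σ x : ℕ) = v := fun v hv => by
    obtain ⟨x, hx⟩ := hb.2 ⟨v, by omega⟩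
    exact ⟨x, by rw [hx]⟩
  have inj : ∀ x y, (σ x : ℕ) = σ y → x = y := fun x y h => hb.1 (Fin.ext h)
  obtain ⟨x0, h0⟩ := sur 0 (by omega)
  obtain ⟨x1, h1⟩ := sur 1 (by omega)
  obtain ⟨z2, hz2⟩ := sur (k - 2) (by omega)
  obtain ⟨z1, hz1⟩ := sur (k - 1) (by omega)
  obtain ⟨z, hz⟩ := sur k (by omega)
  -- `L 2`
  have hL2 : x1 < x0 ∨ (∀ x y, 2 ≤ (σ x : ℕ) → σ x < σ y → x < y) := by
    rcases hL 2 (by omega) with ⟨S, hS, hm, hx⟩ | ⟨x, y, hxy, h, h'⟩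
    · right
      have mem := mem_of_full σ hb.1 S 2 (k + 1) (fun x h => ⟨hx x h, (σ x).2⟩) (by omega)
      intro x y h1 h2
      exact (hm.lt_iff_lt (mem x h1 (by omega)) (mem y (by omega) (by omega))).1 h2
    · left
      have e1 : x = x1 := inj _ _ (by omega)
      have e2 : y = x0 := inj _ _ (by omega)
      rwa [← e1, ← e2]
  have c1 : z < z1 := by
    rcases hR (k - 1) (by omega) with ⟨S, hS, hm, hx⟩ | ⟨x, y, hxy, h, h'⟩
    · exfalso
      have mem := mem_of_full σ hb.1 S 0 (k - 1) (fun x h => ⟨by omega, hx x h⟩) (by omega)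
      have ord : ∀ x y, (σ y : ℕ) < k - 1 → σ x < σ y → x < y := fun x y h1 h2 =>
        (hm.lt_iff_lt (mem x (by omega) (by omega)) (mem y (by omega) (by omega))).1 h2
      have a1 := ord x0 x1 (by omega) (by omega)
      rcases hL2 with h | h
      · omega
      have a2 := h z2 z1 (by omega) (by omega)
      refine hI ⟨insert z1 S, ?_, ?_⟩
      · rw [Finset.card_insert_of_notMem]
        · exact hS
        · intro hh
          have := hx _ hh
          omega
      · intro x hxS y hyS hxy
        simp only [Finset.coe_insert, Set.mem_insert_iff, Finset.mem_coe] at hxS hyS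
        have ne : (σ x : ℕ) ≠ σ y := fun h => hxy.ne (inj _ _ h)
        by_contra hc
        have hlt : σ y < σ x := by omega
        rcases hxS with rfl | hxS
        · rcases hyS with rfl | hyS
          · omega
          have hy1 := hx _ hyS
          by_cases e : y = z2
          · omega
          have ne2 : (σ y : ℕ) ≠ σ z2 := fun h => e (inj _ _ h)
          have := ord y z2 (by omega) (by omega)
          omega
        · have := ord y x (hx _ hxS) hlt
          omega
    · have e1 : x = z := inj _ _ (by omega)
      have e2 : y = z1 := inj _ _ (by omega)
      rwa [← e1, ← e2]
  have c2 : x1 < x0 := by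
    rcases hL2 with h | h
    · exact h
    · have := h z1 z (by omega) (by omega)
      omega
  -- `L 1`
  obtain ⟨c3, c4⟩ : (∀ x y, 1 ≤ (σ x : ℕ) → (σ y : ℕ) < k - 1 → σ x < σ y → x < y) ∧
      (∀ x, 1 ≤ (σ x : ℕ) → (σ x : ℕ) < k - 1 → x < z1) := by
    rcases hL 1 (by omega) with ⟨S, hS, hm, hx⟩ | ⟨x, y, hxy, h, h'⟩
    swap
    · omega
    by_cases hzS : z ∈ S
    · have hz1S : z1 ∉ S := fun h => by
        have := (hm.lt_iff_lt hzS h).2 c1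
        omega
      have mem := mem_of_almost_full σ hb.1 S 1 (k + 1) (fun x h => ⟨hx x h, (σ x).2⟩) (by omega)
        z1 hz1S (by omega) (by omega)
      have mem' : ∀ x, 1 ≤ (σ x : ℕ) → (σ x : ℕ) < k - 1 → x ∈ S := fun x h1 h2 =>
        mem x (by rintro rfl; omega) h1 (by omega)
      refine ⟨fun x y h1 h2 h3 => (hm.lt_iff_lt (mem' x h1 (by omega)) (mem' y (by omega) h2)).1 h3,
        fun x h1 h2 => ?_⟩
      have := (hm.lt_iff_lt (mem' x h1 (by omega)) hzS).1 (by omega)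
      omega
    · have mem := mem_of_almost_full σ hb.1 S 1 (k + 1) (fun x h => ⟨hx x h, (σ x).2⟩) (by omega)
        z hzS (by omega) (by omega)
      have mem' : ∀ x, 1 ≤ (σ x : ℕ) → (σ x : ℕ) ≤ k - 1 → x ∈ S := fun x h1 h2 =>
        mem x (by rintro rfl; omega) h1 (by omega)
      refine ⟨fun x y h1 h2 h3 => (hm.lt_iff_lt (mem' x h1 (by omega))
        (mem' y (by omega) (by omega))).1 h3,
        fun x h1 h2 => (hm.lt_iff_lt (mem' x h1 (by omega)) (mem' z1 (by omega) (by omega))).1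
          (by omega)⟩
  have c5 : x0 < z1 := by
    by_contra h
    have ne : x0 ≠ z1 := by rintro rfl; omega
    exact hD ⟨z, z1, x0, c1, by omega, by omega, by omega⟩
  have c6 : z2 < z := by
    by_contra h
    have ne : z2 ≠ z := by rintro rfl; omega
    have d1 : z < z2 := by omega
    have d2 : x0 < z2 := by
      by_contra h
      have ne : z2 ≠ x0 := by rintro rfl; omega
      exact hD ⟨z, z2, x0, d1, by omega, by omega, by omega⟩
    have d3 := c4 z2 (by omega) (by omega)
    have d4 : ∀ x, x ≠ z1 → x ≤ z2 := by
      intro x hx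
      by_contra hc
      have n1 : (σ x : ℕ) ≠ σ z1 := fun h => hx (inj _ _ h)
      have n2 : (σ x : ℕ) ≠ σ z2 := fun h => by have := inj _ _ h; omega
      have n3 : (σ x : ℕ) ≠ σ z := fun h => by have := inj _ _ h; omega
      have n4 : (σ x : ℕ) ≠ σ x0 := fun h => by have := inj _ _ h; omega
      have := c3 x z2 (by omega) (by omega) (by omega)
      omega
    have d5 : (z1 : ℕ) = k := by
      by_contra hne
      have := d4 (Fin.last k) (by intro h; rw [← h] at hne; simp at hne)
      rw [Fin.le_def] at this
      simp at this
      omega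
    have d6 : (z2 : ℕ) = k - 1 := by
      by_contra hne
      have := d4 ⟨k - 1, by omega⟩ (by intro h; rw [← h] at d5; simp at d5; omega)
      rw [Fin.le_def] at this
      simp at this
      omega
    rcases hT (k - 1) (by omega) with ⟨S, hS, hm, hx⟩ | ⟨x, y, hxy, h, h'⟩
    · have mem := mem_of_full id Function.injective_id S 0 (k - 1)
        (fun x h => ⟨by omega, hx x h⟩) (by omega)
      simp only [id] at mem
      have := hm (mem x1 (by omega) (by omega)) (mem x0 (by omega) (by omega)) c2
      omega
    · have e1 : x = z2 := by omega
      have e2 : y = z1 := by omega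
      subst e1 e2
      omega
  refine ⟨?_, ?_, ?_, ?_⟩
  · intro x y g1 g2 g3
    by_cases t1 : (σ y : ℕ) < k - 1
    · exact c3 x y g1 t1 g2
    by_cases t2 : (σ y : ℕ) = k - 1
    · have : y = z1 := inj _ _ (by omega)
      subst this
      exact c4 x g1 (by omega)
    have : y = z := inj _ _ (by omega)
    subst this
    by_cases t3 : (σ x : ℕ) = k - 2
    · have : x = z2 := inj _ _ (by omega)
      rwa [this]
    · have := c3 x z2 g1 (by omega) (by omega)
      omega
  · intro x y g1 g2
    have e1 : x = z := inj _ _ (by omega)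
    have e2 : y = z1 := inj _ _ (by omega)
    rwa [e1, e2]
  · intro x y g1 g2
    have e1 : x = x1 := inj _ _ (by omega)
    have e2 : y = x0 := inj _ _ (by omega)
    rwa [e1, e2]
  · intro x y g1 g2
    have e1 : x = x0 := inj _ _ (by omega)
    have e2 : y = z1 := inj _ _ (by omega)
    rwa [e1, e2]

theorem tri_of_shape (k : ℕ) (hk : 4 ≤ k) (σ : Fin (k + 1) → Fin (k + 1))
    (hb : Function.Bijective σ) (hs : Shape k σ) : Tricrucial k 3 (k + 1) σ := by
  rw [tri_iff]
  unfold AvoidsPat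
  rw [hasIncr_iff, hasDecr_iff]
  obtain ⟨s1, s2, s3, s4⟩ := hs
  have sur : ∀ v : ℕ, v ≤ k → ∃ x, (σ x : ℕ) = v := fun v hv => by
    obtain ⟨x, hx⟩ := hb.2 ⟨v, by omega⟩
    exact ⟨x, by rw [hx]⟩
  have inj : ∀ x y, (σ x : ℕ) = σ y → x = y := fun x y h => hb.1 (Fin.ext h)
  obtain ⟨x0, h0⟩ := sur 0 (by omega)
  obtain ⟨x1, h1⟩ := sur 1 (by omega)
  obtain ⟨z1, hz1⟩ := sur (k - 1) (by omega)
  obtain ⟨z, hz⟩ := sur k (by omega)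
  have q2 := s2 z z1 hz hz1
  have q3 := s3 x1 x0 h1 h0
  have q4 := s4 x0 z1 h0 hz1
  -- the two long increasing subsequences
  have big : ∀ w w' : Fin (k + 1), w ≠ w' → ∃ S : Finset (Fin (k + 1)), k ≤ S.card + 1 ∧
      ∀ x, x ∈ S ↔ x ≠ w ∧ x ≠ w' := by
    intro w w' hw
    refine ⟨(Finset.univ.erase w).erase w', ?_, ?_⟩
    · rw [Finset.card_erase_of_mem (by simp [hw.symm]), Finset.card_erase_of_mem (by simp)]
      simp; omega
    · intro x; simp; tauto
  have mono : ∀ w, (w = z ∨ w = z1) → ∀ S : Finset (Fin (k + 1)),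
      (∀ x, x ∈ S ↔ x ≠ x0 ∧ x ≠ w) → StrictMonoOn σ (S : Set (Fin (k + 1))) := by
    intro w hw S hS x hx y hy hxy
    have hx := (hS x).1 hx
    have hy := (hS y).1 hy
    have i1 : (σ x : ℕ) ≠ σ y := fun h => hxy.ne (inj _ _ h)
    have i2 : (σ y : ℕ) ≠ σ x0 := fun h => hy.1 (inj _ _ h)
    have i3 : (σ y : ℕ) ≠ σ w := fun h => hy.2 (inj _ _ h)
    have i4 : (σ x : ℕ) ≠ σ w := fun h => hx.2 (inj _ _ h)
    by_contra hc
    have := s1 y x (by omega) (by omega) (by rcases hw with rfl | rfl <;> omega)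
    omega
  have n0z : x0 ≠ z := by rintro rfl; omega
  have n0z1 : x0 ≠ z1 := by rintro rfl; omega
  obtain ⟨A, hA, hA'⟩ := big x0 z n0z
  obtain ⟨B, hB, hB'⟩ := big x0 z1 n0z1
  have mA := mono z (Or.inl rfl) A hA'
  have mB := mono z1 (Or.inr rfl) B hB'
  refine ⟨⟨?_, ?_⟩, ?_, ?_, ?_⟩
  · rintro ⟨S, hS, hm⟩
    have key : ∀ w w' : Fin (k + 1), w ≠ w' → w ∈ S ∨ w' ∈ S := by
      intro w w' hw
      by_contra hc
      push Not at hc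
      have := (insert w (insert w' S)).card_le_univ
      rw [Finset.card_insert_of_notMem (by simp [hw, hc.1]),
        Finset.card_insert_of_notMem hc.2] at this
      simp at this
      omega
    have key2 : ∀ w w' : Fin (k + 1), w < w' → σ w' < σ w → ¬ (w ∈ S ∧ w' ∈ S) := by
      rintro w w' hw hw' ⟨a, b⟩
      have := hm a b hw
      omega
    have a1 := key2 z z1 q2 (by omega)
    have a2 := key2 x1 x0 q3 (by omega)
    have n1z : x1 ≠ z := by rintro rfl; omega
    have n1z1 : x1 ≠ z1 := by rintro rfl; omega
    have b1 := key x0 z n0z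
    have b2 := key x0 z1 n0z1
    have b3 := key x1 z n1z
    have b4 := key x1 z1 n1z1
    tauto
  · rintro ⟨x, y, w, hxy, hyw, g1, g2⟩
    have p1 : (σ y : ℕ) = k - 1 := by
      by_contra hc
      have := s1 y x (by omega) g1 hc
      omega
    by_cases p2 : (σ w : ℕ) = 0
    · have := s4 w y p2 p1
      omega
    · have := s1 w y (by omega) g2 (by omega)
      omega
  · intro v hv
    by_cases h : v ≤ k - 1
    · exact Or.inr ⟨z, z1, q2, by omega, by omega⟩
    · refine Or.inl ⟨A, hA, mA, fun x hx => ?_⟩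
      have := (hA' x).1 hx
      have i3 : (σ x : ℕ) ≠ σ z := fun h => this.2 (inj _ _ h)
      omega
  · intro v hv
    by_cases h : 2 ≤ v
    · exact Or.inr ⟨x1, x0, q3, by omega, by omega⟩
    · refine Or.inl ⟨A, hA, mA, fun x hx => ?_⟩
      have := (hA' x).1 hx
      have i3 : (σ x : ℕ) ≠ σ x0 := fun h => this.1 (inj _ _ h)
      omega
  · intro p hp
    by_cases h : p ≤ (z : ℕ)
    · exact Or.inr ⟨z, z1, q2, by omega, h⟩
    · refine Or.inl ⟨B, hB, mB, fun x hx => ?_⟩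
      have := (hB' x).1 hx
      have i2 : (σ x : ℕ) ≠ σ x0 := fun h => this.1 (inj _ _ h)
      have i3 : (σ x : ℕ) ≠ σ z1 := fun h => this.2 (inj _ _ h)
      by_cases e : x = z
      · subst e; omega
      have i4 : (σ x : ℕ) ≠ σ z := fun h => e (inj _ _ h)
      have := s1 x z (by omega) (by omega) (by omega)
      omega

/-- The permutation with `0` at position `j`, and otherwise `1, 2, …, k-2, k, k-1`. -/
def shapePerm (k : ℕ) (j : Fin (k + 1)) : Equiv.Perm (Fin (k + 1)) :=
  Equiv.swap ⟨k - 1, by omega⟩ (Fin.last k) * Fin.cycleRange j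

theorem swap_val (k : ℕ) (u : Fin (k + 1)) :
    ((Equiv.swap (⟨k - 1, by omega⟩ : Fin (k + 1)) (Fin.last k) u : Fin (k + 1)) : ℕ) =
      if (u : ℕ) = k - 1 then k else if (u : ℕ) = k then k - 1 else u := by
  rw [Equiv.swap_apply_def]
  simp only [Fin.ext_iff, Fin.val_last]
  split_ifs <;> simp

theorem swap_val_zero (k : ℕ) (hk : 4 ≤ k) :
    ((Equiv.swap (⟨k - 1, by omega⟩ : Fin (k + 1)) (Fin.last k) 0 : Fin (k + 1)) : ℕ) = 0 := by
  rw [swap_val, if_neg, if_neg]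
  · rfl
  · simp; omega
  · simp; omega

theorem shape_shapePerm (k : ℕ) (hk : 4 ≤ k) (j : Fin (k + 1)) (h1 : 1 ≤ (j : ℕ))
    (h2 : (j : ℕ) < k) : Shape k (shapePerm k j) := by
  have val : ∀ u : Fin (k + 1),
      ((u : ℕ) = 0 → (((Fin.cycleRange j).symm u : Fin (k + 1)) : ℕ) = j) ∧
      (1 ≤ (u : ℕ) → (u : ℕ) ≤ j → (((Fin.cycleRange j).symm u : Fin (k + 1)) : ℕ) + 1 = u) ∧
      ((j : ℕ) < u → (((Fin.cycleRange j).symm u : Fin (k + 1)) : ℕ) = u) := by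
    intro u
    refine Fin.cases ?_ (fun i => ?_) u
    · simp
    · rw [Fin.cycleRange_symm_succ]
      have a1 : (i : ℕ) < j → ((j.succAbove i : Fin (k + 1)) : ℕ) = i := fun h => by
        rw [Fin.succAbove_of_castSucc_lt _ _ (by rw [Fin.lt_def]; simpa using h)]; simp
      have a2 : (j : ℕ) ≤ i → ((j.succAbove i : Fin (k + 1)) : ℕ) = i + 1 := fun h => by
        rw [Fin.succAbove_of_le_castSucc _ _ (by rw [Fin.le_def]; simpa using h)]; simp
      rw [Fin.val_succ]
      refine ⟨?_, ?_, ?_⟩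
      · omega
      · intro _ h
        rw [a1 (by omega)]
      · intro h
        rw [a2 (by omega)]
  have key : ∀ x : Fin (k + 1), ∃ u : ℕ, u ≤ k ∧ (u = 0 → (x : ℕ) = j) ∧
      (1 ≤ u → u ≤ j → (x : ℕ) + 1 = u) ∧ ((j : ℕ) < u → (x : ℕ) = u) ∧
      (u = k - 1 → ((shapePerm k j x : Fin (k + 1)) : ℕ) = k) ∧
      (u = k → ((shapePerm k j x : Fin (k + 1)) : ℕ) = k - 1) ∧
      (u < k - 1 → ((shapePerm k j x : Fin (k + 1)) : ℕ) = u) := by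
    intro x
    have hv := val (Fin.cycleRange j x)
    rw [Equiv.symm_apply_apply] at hv
    have hs : ((shapePerm k j x : Fin (k + 1)) : ℕ) = _ := swap_val k (Fin.cycleRange j x)
    refine ⟨(Fin.cycleRange j x : ℕ), by omega, hv.1, hv.2.1, hv.2.2, ?_, ?_, ?_⟩
    · intro h
      rw [hs, if_pos h]
    · intro h
      rw [hs, if_neg (by omega), if_pos h]
    · intro h
      rw [hs, if_neg (by omega), if_neg (by omega)]
  refine ⟨?_, ?_, ?_, ?_⟩
  all_goals
    intro x y
    obtain ⟨u, hu⟩ := key x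
    obtain ⟨w, hw⟩ := key y
    simp only [Fin.lt_def]
    omega

theorem eq_of_shape (k : ℕ) (hk : 4 ≤ k) (σ : Equiv.Perm (Fin (k + 1))) (hs : Shape k σ) :
    1 ≤ (σ.symm 0 : ℕ) ∧ (σ.symm 0 : ℕ) < k ∧ shapePerm k (σ.symm 0) = σ := by
  obtain ⟨s1, s2, s3, s4⟩ := hs
  have q3 := s3 (σ.symm ⟨1, by omega⟩) (σ.symm 0) (by simp) (by simp)
  have q4 := s4 (σ.symm 0) (σ.symm ⟨k - 1, by omega⟩) (by simp) (by simp)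
  refine ⟨by omega, by omega, ?_⟩
  set s := Equiv.swap (⟨k - 1, by omega⟩ : Fin (k + 1)) (Fin.last k) with hsdef
  have hmono : StrictMono (fun i : Fin k => σ.symm (s i.succ)) := by
    intro a b hab
    have va := swap_val k a.succ
    have vb := swap_val k b.succ
    rw [← hsdef] at va vb
    simp only [Fin.val_succ] at va vb
    rw [Fin.lt_def] at hab
    by_cases h : (s a.succ : ℕ) = k
    · exact s2 _ _ (by simpa using h) (by
        simp only [Equiv.apply_symm_apply]
        split_ifs at * <;> omega)
    · refine s1 _ _ ?_ ?_ ?_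
      all_goals
        simp only [Equiv.apply_symm_apply, Fin.lt_def]
        split_ifs at * <;> omega
  have s0 : s 0 = 0 := by
    apply Fin.ext
    rw [swap_val_zero k hk]; rfl
  have hr : Set.range (fun i : Fin k => σ.symm (s i.succ)) = Set.range (σ.symm 0).succAbove := by
    rw [Fin.range_succAbove]
    ext x
    simp only [Set.mem_range, Set.mem_compl_iff, Set.mem_singleton_iff]
    constructor
    · rintro ⟨i, rfl⟩ h
      have h := σ.symm.injective h
      rw [← s0] at h
      exact Fin.succ_ne_zero i (s.injective h)
    · intro h
      have : s (σ x) ≠ 0 := by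
        intro h'
        apply h
        have : s (σ x) = s 0 := by rw [h', s0]
        rw [← s.injective this]; simp
      obtain ⟨i, hi⟩ := Fin.exists_succ_eq.2 this
      refine ⟨i, ?_⟩
      rw [hi, hsdef]; simp
  have heq := (StrictMono.range_inj hmono (Fin.strictMono_succAbove _)).1 hr
  have hinv : (Fin.cycleRange (σ.symm 0)).symm = s.trans σ.symm := by
    ext u
    refine congrArg _ (?_ : _ = _)
    refine Fin.cases ?_ (fun i => ?_) u
    · simp [s0]
    · rw [Fin.cycleRange_symm_succ, ← congrFun heq i]; rfl
  have hc : Fin.cycleRange (σ.symm 0) = σ.trans s := by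
    rw [← Equiv.symm_symm (Fin.cycleRange (σ.symm 0)), hinv]
    ext u
    simp [hsdef]
  unfold shapePerm
  rw [hc]
  ext u
  simp [hsdef]

theorem card_shape (k : ℕ) (hk : 4 ≤ k) :
    Nat.card {σ : Equiv.Perm (Fin (k + 1)) // Tricrucial k 3 (k + 1) ⇑σ} = k - 1 := by
  have e : {σ : Equiv.Perm (Fin (k + 1)) // Tricrucial k 3 (k + 1) ⇑σ} ≃
      {j : Fin (k + 1) // 1 ≤ (j : ℕ) ∧ (j : ℕ) < k} :=
    { toFun := fun σ => ⟨σ.1.symm 0, by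
        have := eq_of_shape k hk σ.1 (shape_of_tri k hk _ σ.1.bijective σ.2)
        exact ⟨this.1, this.2.1⟩⟩
      invFun := fun j => ⟨shapePerm k j.1, tri_of_shape k hk _ (Equiv.bijective _)
        (shape_shapePerm k hk j.1 j.2.1 j.2.2)⟩
      left_inv := fun σ => Subtype.ext
        (eq_of_shape k hk σ.1 (shape_of_tri k hk _ σ.1.bijective σ.2)).2.2
      right_inv := fun j => by
        apply Subtype.ext
        change (shapePerm k j.1).symm 0 = j.1
        rw [Equiv.symm_apply_eq]
        apply Fin.ext
        have : shapePerm k j.1 j.1 = Equiv.swap ⟨k - 1, by omega⟩ (Fin.last k) 0 := by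
          unfold shapePerm
          rw [Equiv.Perm.mul_apply, Fin.cycleRange_self]
        rw [this, swap_val_zero k hk]; rfl }
  have e2 : {j : Fin (k + 1) // 1 ≤ (j : ℕ) ∧ (j : ℕ) < k} ≃ Fin (k - 1) :=
    { toFun := fun j => ⟨j.1 - 1, by have := j.2; omega⟩
      invFun := fun i => ⟨⟨i + 1, by omega⟩, by simp; omega⟩
      left_inv := fun j => by
        apply Subtype.ext; apply Fin.ext
        have := j.2
        simp; omega
      right_inv := fun i => by apply Fin.ext; simp }
  rw [Nat.card_congr (e.trans e2)]
  simp

/-- decidable form for `k = 3`. -/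
def Bad3 (n : ℕ) (σ : Fin n → Fin n) : Prop :=
  (∃ x y : Fin n, x < y ∧ σ x < σ y ∧ ∃ z, y < z ∧ σ y < σ z) ∨
  (∃ x y : Fin n, x < y ∧ σ y < σ x ∧ ∃ z, y < z ∧ σ z < σ y)

instance (n : ℕ) (σ : Fin n → Fin n) : Decidable (Bad3 n σ) := by
  unfold Bad3; infer_instance

theorem bad3_iff (n : ℕ) (σ : Fin n → Fin n) : ContainsPat 3 3 n σ ↔ Bad3 n σ := by
  unfold ContainsPat Bad3
  rw [hasIncr3_iff, hasDecr_iff]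
  refine or_congr (exists_congr fun x => exists_congr fun y => ?_)
    (exists_congr fun x => exists_congr fun y => ?_)
  · constructor
    · rintro ⟨z, a, b, c, d⟩
      exact ⟨a, c, z, b, d⟩
    · rintro ⟨a, c, z, b, d⟩
      exact ⟨z, a, b, c, d⟩
  · constructor
    · rintro ⟨z, a, b, c, d⟩
      exact ⟨a, c, z, b, d⟩
    · rintro ⟨a, c, z, b, d⟩
      exact ⟨z, a, b, c, d⟩

theorem tri3_iff (n : ℕ) (σ : Fin n → Fin n) : Tricrucial 3 3 n σ ↔ ¬ Bad3 n σ ∧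
    ∀ i, Bad3 (n + 1) (rightExt σ i) ∧ Bad3 (n + 1) (leftExt σ i) ∧ Bad3 (n + 1) (topExt σ i) := by
  unfold Tricrucial Bicrucial RightCrucial LeftCrucial
  have : AvoidsPat 3 3 n σ ↔ ¬ Bad3 n σ := by
    rw [← bad3_iff]; unfold AvoidsPat ContainsPat; tauto
  simp only [this, bad3_iff, forall_and]
  tauto

theorem card_three :
    Nat.card {σ : Equiv.Perm (Fin (3 + 1)) // Tricrucial 3 3 (3 + 1) ⇑σ} = 4 := by
  rw [Nat.card_congr (Equiv.subtypeEquivRight (fun σ : Equiv.Perm (Fin (3 + 1)) =>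
    tri3_iff (3 + 1) σ)), Nat.card_eq_fintype_card]
  decide +kernel

/-- minimal `(k,3)`-tricrucial permutations: for `k ≥ 3`, every
`(k,3)`-tricrucial permutation has length at least `k+1`, one of length `k+1` exists,
and the number of `(k,3)`-tricrucial permutations of length `k+1` is `4` if `k = 3`
and `k-1` if `k > 3`. -/
theorem count_minimal_k3_tricrucial (k : ℕ) (hk : 3 ≤ k) :
    (∀ (n : ℕ) (σ : Fin n → Fin n), Function.Bijective σ →
      Tricrucial k 3 n σ → k + 1 ≤ n) ∧
    (∃ σ : Equiv.Perm (Fin (k + 1)), Tricrucial k 3 (k + 1) ⇑σ) ∧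
    Nat.card {σ : Equiv.Perm (Fin (k + 1)) // Tricrucial k 3 (k + 1) ⇑σ} =
      if k = 3 then 4 else k - 1 := by
  have hc : Nat.card {σ : Equiv.Perm (Fin (k + 1)) // Tricrucial k 3 (k + 1) ⇑σ} =
      if k = 3 then 4 else k - 1 := by
    split_ifs with h
    · subst h
      exact card_three
    · exact card_shape k (by omega)
  refine ⟨fun n σ hb ht => lower_bound k hk n σ hb ht, ?_, hc⟩
  by_contra hne
  have : IsEmpty {σ : Equiv.Perm (Fin (k + 1)) // Tricrucial k 3 (k + 1) ⇑σ} :=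
    ⟨fun σ => hne ⟨σ.1, σ.2⟩⟩
  rw [Nat.card_of_isEmpty] at hc
  split_ifs at hc <;> omega
end

section
/- Let k ≥ ℓ ≥ 3. The number of (k,ℓ)-quadrocrucial permutations of length k+2ℓ−5 (the minimal possible length of a (k,ℓ)-quadrocrucial permutation) equals 4 if k = ℓ = 3, equals 2 if k = ℓ > 3, and equals 1 if k > ℓ. -/
namespace QCaux

open Finset

def Inc {n : ℕ} (σ : Fin n → Fin n) (m : ℕ) (S : Finset (Fin n)) : Prop :=
  S.card = m ∧ StrictMonoOn σ (S : Set (Fin n))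

def Dec {n : ℕ} (σ : Fin n → Fin n) (m : ℕ) (S : Finset (Fin n)) : Prop :=
  S.card = m ∧ StrictAntiOn σ (S : Set (Fin n))

lemma hasIncr_iff {k n : ℕ} (σ : Fin n → Fin n) : HasIncr k n σ ↔ ∃ S, Inc σ k S := by
  constructor
  · rintro ⟨f, hf, hg⟩
    refine ⟨univ.map ⟨f, hf.injective⟩, by simp, ?_⟩
    intro x hx y hy hxy
    simp only [coe_map, Function.Embedding.coeFn_mk, coe_univ, Set.image_univ, Set.mem_range] at hx hy
    obtain ⟨a, rfl⟩ := hx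
    obtain ⟨b, rfl⟩ := hy
    exact hg (hf.lt_iff_lt.1 hxy)
  · rintro ⟨S, hc, hS⟩
    refine ⟨S.orderEmbOfFin hc, (S.orderEmbOfFin hc).strictMono, ?_⟩
    intro a b hab
    exact hS (S.orderEmbOfFin_mem hc a) (S.orderEmbOfFin_mem hc b)
      ((S.orderEmbOfFin hc).strictMono hab)

lemma hasDecr_iff {k n : ℕ} (σ : Fin n → Fin n) : HasDecr k n σ ↔ ∃ S, Dec σ k S := by
  constructor
  · rintro ⟨f, hf, hg⟩
    refine ⟨univ.map ⟨f, hf.injective⟩, by simp, ?_⟩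
    intro x hx y hy hxy
    simp only [coe_map, Function.Embedding.coeFn_mk, coe_univ, Set.image_univ, Set.mem_range] at hx hy
    obtain ⟨a, rfl⟩ := hx
    obtain ⟨b, rfl⟩ := hy
    exact hg (hf.lt_iff_lt.1 hxy)
  · rintro ⟨S, hc, hS⟩
    refine ⟨S.orderEmbOfFin hc, (S.orderEmbOfFin hc).strictMono, ?_⟩
    intro a b hab
    exact hS (S.orderEmbOfFin_mem hc a) (S.orderEmbOfFin_mem hc b)
      ((S.orderEmbOfFin hc).strictMono hab)

lemma map_pre {n : ℕ} (p : Fin (n+1)) (S : Finset (Fin (n+1))) :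
    (univ.filter (fun j => p.succAbove j ∈ S)).map p.succAboveEmb = S.erase p := by
  ext x
  simp only [mem_map, mem_filter, mem_univ, true_and, Fin.succAboveEmb_apply, mem_erase]
  constructor
  · rintro ⟨a, ha, rfl⟩
    exact ⟨Fin.succAbove_ne p a, ha⟩
  · rintro ⟨hx, hS⟩
    obtain ⟨a, rfl⟩ := Fin.exists_succAbove_eq hx
    exact ⟨a, hS, rfl⟩

lemma ext_incr {n k : ℕ} (σ : Fin n → Fin n) (τ : Fin (n+1) → Fin (n+1)) (p v : Fin (n+1))
    (hp : τ p = v) (h : ∀ j, τ (p.succAbove j) = v.succAbove (σ j)) (hk : 1 ≤ k)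
    (hav : ¬ ∃ S, Inc σ k S) :
    (∃ S, Inc τ k S) ↔
      ∃ I, Inc σ (k-1) I ∧ ∀ j ∈ I, (j.castSucc < p ↔ (σ j).castSucc < v) := by
  constructor
  · rintro ⟨S, hc, hS⟩
    have hmono : StrictMonoOn σ ((univ.filter (fun j => p.succAbove j ∈ S) : Finset (Fin n)) : Set (Fin n)) := by
      intro x hx y hy hxy
      simp only [coe_filter, mem_univ, true_and, Set.mem_ofPred_eq] at hx hy
      have := hS hx hy (Fin.succAbove_lt_succAbove_iff.2 hxy)
      rw [h, h] at this
      exact Fin.succAbove_lt_succAbove_iff.1 this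
    have hcard : (univ.filter (fun j => p.succAbove j ∈ S)).card = (S.erase p).card := by
      rw [← map_pre, card_map]
    have hpS : p ∈ S := by
      by_contra hpS
      exact hav ⟨_, by rw [hcard, erase_eq_of_notMem hpS, hc], hmono⟩
    refine ⟨_, ⟨by rw [hcard, card_erase_of_mem hpS, hc], hmono⟩, ?_⟩
    intro j hj
    simp only [mem_filter, mem_univ, true_and] at hj
    have := hS.lt_iff_lt (a := p.succAbove j) (b := p) hj hpS
    rw [h, hp, Fin.succAbove_lt_iff_castSucc_lt, Fin.succAbove_lt_iff_castSucc_lt] at this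
    exact this.symm
  · rintro ⟨I, ⟨hc, hI⟩, hj⟩
    refine ⟨insert p (I.map p.succAboveEmb), ?_, ?_⟩
    · rw [card_insert_of_notMem, card_map, hc]
      · omega
      · simp [Fin.succAbove_ne]
    · intro x hx y hy hxy
      simp only [coe_insert, coe_map, Fin.coe_succAboveEmb, Set.mem_insert_iff, Set.mem_image, mem_coe] at hx hy
      rcases hx with rfl | ⟨a, ha, rfl⟩ <;> rcases hy with rfl | ⟨b, hb, rfl⟩
      · exact absurd hxy (lt_irrefl _)
      · rw [h, hp, Fin.lt_succAbove_iff_le_castSucc]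
        rw [Fin.lt_succAbove_iff_le_castSucc] at hxy
        have := hj b hb
        rw [← not_iff_not, not_lt, not_lt] at this
        exact this.1 hxy
      · rw [h, hp, Fin.succAbove_lt_iff_castSucc_lt]
        rw [Fin.succAbove_lt_iff_castSucc_lt] at hxy
        exact (hj a ha).1 hxy
      · rw [h, h, Fin.succAbove_lt_succAbove_iff]
        exact hI ha hb (Fin.succAbove_lt_succAbove_iff.1 hxy)

lemma dec_iff {n m : ℕ} (σ : Fin n → Fin n) (S : Finset (Fin n)) :
    Dec σ m S ↔ Inc (Fin.rev ∘ σ) m S := by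
  unfold Dec Inc StrictAntiOn StrictMonoOn
  simp

lemma ext_decr {n k : ℕ} (σ : Fin n → Fin n) (τ : Fin (n+1) → Fin (n+1)) (p v : Fin (n+1))
    (hp : τ p = v) (h : ∀ j, τ (p.succAbove j) = v.succAbove (σ j)) (hk : 1 ≤ k)
    (hav : ¬ ∃ S, Dec σ k S) :
    (∃ S, Dec τ k S) ↔
      ∃ I, Dec σ (k-1) I ∧ ∀ j ∈ I, (j.castSucc < p ↔ v ≤ (σ j).castSucc) := by
  simp only [dec_iff] at hav ⊢
  rw [ext_incr (Fin.rev ∘ σ) (Fin.rev ∘ τ) p v.rev (by simp [hp])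
    (by intro j; simp [h, Fin.rev_succAbove]) hk hav]
  have key : ∀ j, ((Fin.rev ∘ σ) j).castSucc < v.rev ↔ v ≤ (σ j).castSucc := by
    intro j
    rw [Fin.lt_def, Fin.le_def]
    have := (σ j).isLt
    have := v.isLt
    simp [Fin.val_rev]
    omega
  simp only [key]

lemma contains_iff {n k l : ℕ} (σ : Fin n → Fin n) (τ : Fin (n+1) → Fin (n+1)) (p v : Fin (n+1))
    (hk : 1 ≤ k) (hl : 1 ≤ l) (hav : AvoidsPat k l n σ)
    (hp : τ p = v) (h : ∀ j, τ (p.succAbove j) = v.succAbove (σ j)) :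
    ContainsPat k l (n+1) τ ↔
      (∃ I, Inc σ (k-1) I ∧ ∀ j ∈ I, (j.castSucc < p ↔ (σ j).castSucc < v)) ∨
      (∃ I, Dec σ (l-1) I ∧ ∀ j ∈ I, (j.castSucc < p ↔ v ≤ (σ j).castSucc)) := by
  unfold ContainsPat
  unfold AvoidsPat at hav
  rw [hasIncr_iff, hasDecr_iff] at hav ⊢
  rw [ext_incr σ τ p v hp h hk hav.1, ext_decr σ τ p v hp h hl hav.2]

lemma abs_iff {n : ℕ} (f : Fin n → Fin n) (P Q : Finset (Fin n) → Prop)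
    (hP : ∀ S, P S → S.Nonempty) (hQ : ∀ S, Q S → S.Nonempty) :
    (∀ v : Fin (n+1), (∃ I, P I ∧ ∀ j ∈ I, (f j).castSucc < v) ∨
      (∃ D, Q D ∧ ∀ j ∈ D, v ≤ (f j).castSucc)) ↔
    ∃ I D, P I ∧ Q D ∧ ∀ x ∈ I, ∀ y ∈ D, f x ≤ f y := by
  constructor
  · intro h
    classical
    have hex : ∃ v : ℕ, v ≤ n ∧ ∃ I, P I ∧ ∀ j ∈ I, (f j : ℕ) < v := by
      refine ⟨n, le_rfl, ?_⟩
      rcases h (Fin.last n) with ⟨I, hI, hj⟩ | ⟨D, hD, hj⟩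
      · exact ⟨I, hI, fun j hj => (f j).isLt⟩
      · obtain ⟨j, hjD⟩ := hQ D hD
        have := hj j hjD
        rw [Fin.le_def] at this
        have := (f j).isLt
        simp at *
        omega
    obtain ⟨hvn, I, hI, hIv⟩ := Nat.find_spec hex
    have hmin := fun m => Nat.find_min hex (m := m)
    set v := Nat.find hex with hv
    obtain ⟨i0, hi0⟩ := hP I hI
    have h0 := hIv i0 hi0
    have h1 := hmin (v-1) (by omega)
    rcases h ⟨v-1, by omega⟩ with ⟨I', hI', hj⟩ | ⟨D, hD, hj⟩
    · exact absurd ⟨by omega, I', hI', fun j hjI => by simpa [Fin.lt_def] using hj j hjI⟩ h1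
    · refine ⟨I, D, hI, hD, fun x hx y hy => ?_⟩
      have a := hIv x hx
      have b := hj y hy
      simp only [Fin.le_def, Fin.val_castSucc] at *
      omega
  · rintro ⟨I, D, hI, hD, h⟩ v
    by_cases hc : ∀ j ∈ I, (f j).castSucc < v
    · exact Or.inl ⟨I, hI, hc⟩
    · push Not at hc
      obtain ⟨j, hj, hjv⟩ := hc
      exact Or.inr ⟨D, hD, fun y hy => hjv.trans (Fin.castSucc_le_castSucc_iff.2 (h j hj y hy))⟩

structure QC {n : ℕ} (k l : ℕ) (σ : Fin n → Fin n) : Prop where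
  ai : ¬ ∃ S, Inc σ k S
  ad : ¬ ∃ S, Dec σ l S
  R : ∃ I D, Inc σ (k-1) I ∧ Dec σ (l-1) D ∧ ∀ x ∈ I, ∀ y ∈ D, σ x ≤ σ y
  L : ∃ D I, Dec σ (l-1) D ∧ Inc σ (k-1) I ∧ ∀ x ∈ D, ∀ y ∈ I, σ x ≤ σ y
  T : ∃ I D, Inc σ (k-1) I ∧ Dec σ (l-1) D ∧ ∀ x ∈ I, ∀ y ∈ D, x ≤ y
  B : ∃ D I, Dec σ (l-1) D ∧ Inc σ (k-1) I ∧ ∀ x ∈ D, ∀ y ∈ I, x ≤ y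

lemma quad_iff {n k l : ℕ} (hk : 2 ≤ k) (hl : 2 ≤ l) (σ : Fin n → Fin n) :
    Quadrocrucial k l n σ ↔ QC k l σ := by
  have hP : ∀ S, Inc σ (k-1) S → S.Nonempty := fun S h => by
    rw [← card_pos, h.1]; omega
  have hQ : ∀ S, Dec σ (l-1) S → S.Nonempty := fun S h => by
    rw [← card_pos, h.1]; omega
  have hR : AvoidsPat k l n σ → ((∀ i, ContainsPat k l (n+1) (rightExt σ i)) ↔
      ∃ I D, Inc σ (k-1) I ∧ Dec σ (l-1) D ∧ ∀ x ∈ I, ∀ y ∈ D, σ x ≤ σ y) := by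
    intro hav
    rw [← abs_iff σ _ _ hP hQ]
    refine forall_congr' fun i => ?_
    rw [contains_iff σ _ (Fin.last n) i (by omega) (by omega) hav (by simp [rightExt])
      (by intro j; simp [rightExt])]
    simp [Fin.castSucc_lt_last]
  have hL : AvoidsPat k l n σ → ((∀ i, ContainsPat k l (n+1) (leftExt σ i)) ↔
      ∃ D I, Dec σ (l-1) D ∧ Inc σ (k-1) I ∧ ∀ x ∈ D, ∀ y ∈ I, σ x ≤ σ y) := by
    intro hav
    rw [← abs_iff σ _ _ hQ hP]
    refine forall_congr' fun i => ?_
    rw [contains_iff σ _ 0 i (by omega) (by omega) hav (by simp [leftExt])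
      (by intro j; simp [leftExt]), or_comm]
    simp
  have hT : AvoidsPat k l n σ → ((∀ i, ContainsPat k l (n+1) (topExt σ i)) ↔
      ∃ I D, Inc σ (k-1) I ∧ Dec σ (l-1) D ∧ ∀ x ∈ I, ∀ y ∈ D, x ≤ y) := by
    intro hav
    refine Iff.trans ?_ (abs_iff id _ _ hP hQ)
    refine forall_congr' fun i => ?_
    rw [contains_iff σ _ i (Fin.last n) (by omega) (by omega) hav (by simp [topExt])
      (by intro j; simp [topExt])]
    simp [Fin.castSucc_lt_last, Fin.castSucc_ne_last]
  have hB : AvoidsPat k l n σ → ((∀ i, ContainsPat k l (n+1) (botExt σ i)) ↔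
      ∃ D I, Dec σ (l-1) D ∧ Inc σ (k-1) I ∧ ∀ x ∈ D, ∀ y ∈ I, x ≤ y) := by
    intro hav
    refine Iff.trans ?_ (abs_iff id _ _ hQ hP)
    refine forall_congr' fun i => ?_
    rw [contains_iff σ _ i 0 (by omega) (by omega) hav (by simp [botExt])
      (by intro j; simp [botExt]), or_comm]
    simp
  have hA : AvoidsPat k l n σ ↔ (¬ ∃ S, Inc σ k S) ∧ ¬ ∃ S, Dec σ l S := by
    unfold AvoidsPat
    rw [hasIncr_iff, hasDecr_iff]
  constructor
  · rintro ⟨⟨⟨⟨ha, r⟩, ⟨_, lf⟩⟩, t⟩, b⟩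
    exact ⟨(hA.1 ha).1, (hA.1 ha).2, (hR ha).1 r, (hL ha).1 lf, (hT ha).1 t, (hB ha).1 b⟩
  · rintro ⟨a1, a2, r, lf, t, b⟩
    have ha := hA.2 ⟨a1, a2⟩
    exact ⟨⟨⟨⟨ha, (hR ha).2 r⟩, ⟨ha, (hL ha).2 lf⟩⟩, (hT ha).2 t⟩, (hB ha).2 b⟩

lemma inter_le {n a b : ℕ} {σ : Fin n → Fin n} {I D : Finset (Fin n)}
    (hI : Inc σ a I) (hD : Dec σ b D) : (I ∩ D).card ≤ 1 := by
  rw [card_le_one]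
  intro x hx y hy
  rw [mem_inter] at hx hy
  by_contra hne
  rcases lt_or_gt_of_ne hne with h | h
  · exact lt_asymm (hI.2 hx.1 hy.1 h) (hD.2 hx.2 hy.2 h)
  · exact lt_asymm (hI.2 hy.1 hx.1 h) (hD.2 hy.2 hx.2 h)

/-- two increasing sequences meeting at the end of one and the start of the other. -/
lemma chain_incr {n k : ℕ} {σ : Fin n → Fin n} {I J : Finset (Fin n)} (hk : 3 ≤ k)
    (hI : Inc σ (k-1) I) (hJ : Inc σ (k-1) J) {x : Fin n} (xI : x ∈ I) (xJ : x ∈ J)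
    (h1 : ∀ a ∈ I, a ≤ x) (h2 : ∀ b ∈ J, x ≤ b) : ∃ S, Inc σ k S := by
  obtain ⟨y, hyJ, hyx⟩ : ∃ y ∈ J, y ≠ x := by
    apply exists_mem_ne
    rw [hJ.1]; omega
  have hxy : x < y := lt_of_le_of_ne (h2 y hyJ) hyx.symm
  have hyI : y ∉ I := fun h => absurd (h1 y h) (not_le.2 hxy)
  refine ⟨insert y I, by rw [card_insert_of_notMem hyI, hI.1]; omega, ?_⟩
  intro a ha b hb hab
  simp only [coe_insert, Set.mem_insert_iff, mem_coe] at ha hb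
  rcases ha with rfl | ha <;> rcases hb with rfl | hb
  · exact absurd hab (lt_irrefl _)
  · exact absurd (hxy.trans hab) (not_lt.2 (h1 b hb))
  · exact lt_of_le_of_lt ((hI.2.le_iff_le ha xI).2 (h1 a ha)) (hJ.2 xJ hyJ hxy)
  · exact hI.2 ha hb hab

/-- structure of increasing sequences when there are two disjoint decreasing ones. -/
lemma struct {n k l : ℕ} {σ : Fin n → Fin n} (hn : n + 5 = k + 2 * l) (hk : 4 ≤ k) (hl : 3 ≤ l)
    {D E I : Finset (Fin n)} (hD : Dec σ (l-1) D) (hE : Dec σ (l-1) E) (hdis : Disjoint D E)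
    (hI : Inc σ (k-1) I) :
    ((D ∪ E)ᶜ).card = k - 3 ∧ (D ∪ E)ᶜ ⊆ I ∧ ∃ a ∈ D, ∃ c ∈ E, a ∈ I ∧ c ∈ I ∧
      ∀ x ∈ I, x = a ∨ x = c ∨ x ∈ (D ∪ E)ᶜ := by
  have h1 := inter_le hI hD
  have h2 := inter_le hI hE
  have hc : ((D ∪ E)ᶜ).card = k - 3 := by
    rw [card_compl, card_union_of_disjoint hdis, hD.1, hE.1, Fintype.card_fin]; omega
  have hsplit : I.card = (I ∩ D).card + (I ∩ E).card + (I ∩ (D ∪ E)ᶜ).card := by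
    rw [← card_inter_add_card_sdiff I (D ∪ E), inter_union_distrib_left, card_union_of_disjoint,
      sdiff_eq_inter_compl]
    exact hdis.mono inter_subset_right inter_subset_right
  have h3 : (I ∩ (D ∪ E)ᶜ).card ≤ k - 3 := hc ▸ card_le_card inter_subset_right
  have hIc := hI.1
  have e1 : (I ∩ D).card = 1 := by omega
  have e2 : (I ∩ E).card = 1 := by omega
  have e3 : (I ∩ (D ∪ E)ᶜ) = (D ∪ E)ᶜ :=
    eq_of_subset_of_card_le inter_subset_right (by omega)
  obtain ⟨a, ha⟩ := card_eq_one.1 e1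
  obtain ⟨c, hcc⟩ := card_eq_one.1 e2
  have haa : a ∈ I ∩ D := by rw [ha]; simp
  have hca : c ∈ I ∩ E := by rw [hcc]; simp
  rw [mem_inter] at haa hca
  refine ⟨hc, inter_eq_right.1 e3, a, haa.2, c, hca.2, haa.1, hca.1, ?_⟩
  intro x hx
  by_cases hxD : x ∈ D
  · left
    have : x ∈ I ∩ D := mem_inter.2 ⟨hx, hxD⟩
    rw [ha] at this; simpa using this
  by_cases hxE : x ∈ E
  · right; left
    have : x ∈ I ∩ E := mem_inter.2 ⟨hx, hxE⟩
    rw [hcc] at this; simpa using this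
  · right; right; simp [hxD, hxE]

lemma mem_iff_of_initial {n : ℕ} (S : Finset (Fin n)) (h : ∀ x ∈ S, ∀ y, y ∉ S → x < y)
    (x : Fin n) : x ∈ S ↔ (x : ℕ) < S.card := by
  constructor
  · intro hx
    have : Iic x ⊆ S := by
      intro y hy
      by_contra hyS
      exact absurd (h x hx y hyS) (not_lt.2 (mem_Iic.1 hy))
    have := card_le_card this
    rw [Fin.card_Iic] at this
    omega
  · intro hx
    by_contra hxS
    have : S ⊆ Iio x := fun y hy => mem_Iio.2 (h y hy x hxS)
    have := card_le_card this
    rw [Fin.card_Iio] at this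
    omega

/-- underlying natural-number function of the canonical permutation. -/
def kap (k l i : ℕ) : ℕ :=
  if i + 1 < l then l - 2 - i else if i + 4 < l + k then i else 2 * k + 3 * l - 10 - i

def canon (n k l : ℕ) (hn : n + 5 = k + 2 * l) (hk : 3 ≤ k) (hl : 3 ≤ l) : Equiv.Perm (Fin n) where
  toFun i := ⟨kap k l i, by have := i.isLt; unfold kap; split_ifs <;> omega⟩
  invFun i := ⟨kap k l i, by have := i.isLt; unfold kap; split_ifs <;> omega⟩
  left_inv i := by
    have := i.isLt; ext; simp only [kap]; split_ifs <;> omega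
  right_inv i := by
    have := i.isLt; ext; simp only [kap]; split_ifs <;> omega

lemma canon_val {n k l : ℕ} (hn : n + 5 = k + 2 * l) (hk : 3 ≤ k) (hl : 3 ≤ l) (i : Fin n) :
    (canon n k l hn hk hl i : ℕ) = kap k l i := rfl

lemma eq_canon {n k l : ℕ} (hn : n + 5 = k + 2 * l) (hk : 4 ≤ k) (hl : 3 ≤ l)
    (σ : Equiv.Perm (Fin n)) {B C T : Finset (Fin n)}
    (cB : B.card = l - 1) (cC : C.card = k - 3) (cov : ∀ x, x ∈ B ∨ x ∈ C ∨ x ∈ T)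
    (dBC : ∀ x ∈ B, ∀ y ∈ C, x < y ∧ σ x < σ y) (dBT : ∀ x ∈ B, ∀ y ∈ T, x < y ∧ σ x < σ y)
    (dCT : ∀ x ∈ C, ∀ y ∈ T, x < y ∧ σ x < σ y)
    (aB : StrictAntiOn σ (B : Set (Fin n))) (mC : StrictMonoOn σ (C : Set (Fin n)))
    (aT : StrictAntiOn σ (T : Set (Fin n))) :
    σ = canon n k l hn (by omega) hl := by
  have hB : ∀ x, x ∈ B ↔ (x : ℕ) < l - 1 := by
    intro x
    rw [mem_iff_of_initial B _ x, cB]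
    intro x hx y hy
    rcases cov y with h | h | h
    · exact absurd h hy
    · exact (dBC x hx y h).1
    · exact (dBT x hx y h).1
  have hdis : Disjoint B C := by
    rw [disjoint_left]
    intro x hx hx'
    exact lt_irrefl _ (dBC x hx x hx').1
  have hBC : ∀ x, x ∈ B ∪ C ↔ (x : ℕ) < l + k - 4 := by
    intro x
    rw [mem_iff_of_initial (B ∪ C) _ x, card_union_of_disjoint hdis, cB, cC]
    · omega
    intro x hx y hy
    rw [mem_union] at hx hy
    push Not at hy
    rcases cov y with h | h | h
    · exact absurd h hy.1
    · exact absurd h hy.2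
    · rcases hx with hx | hx
      · exact (dBT x hx y h).1
      · exact (dCT x hx y h).1
  have hT : ∀ x : Fin n, ¬ (x : ℕ) < l + k - 4 → x ∈ T := by
    intro x hx
    rw [← hBC, mem_union] at hx
    push Not at hx
    rcases cov x with h | h | h
    · exact absurd h hx.1
    · exact absurd h hx.2
    · exact h
  have hC : ∀ x : Fin n, ¬ (x : ℕ) < l - 1 → (x : ℕ) < l + k - 4 → x ∈ C := by
    intro x hx hx'
    rw [← hB] at hx
    rw [← hBC, mem_union] at hx'
    exact hx'.resolve_left hx
  have key : ∀ i j : Fin n, kap k l i < kap k l j → σ i < σ j := by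
    intro i j hij
    have hi := i.isLt
    have hj := j.isLt
    by_cases i1 : (i : ℕ) < l - 1
    · by_cases j1 : (j : ℕ) < l - 1
      · refine aB ((hB j).2 j1) ((hB i).2 i1) ?_
        rw [Fin.lt_def]
        unfold kap at hij
        split_ifs at hij <;> omega
      · by_cases j2 : (j : ℕ) < l + k - 4
        · exact (dBC i ((hB i).2 i1) j (hC j j1 j2)).2
        · exact (dBT i ((hB i).2 i1) j (hT j j2)).2
    · by_cases i2 : (i : ℕ) < l + k - 4
      · by_cases j2 : (j : ℕ) < l + k - 4
        · have j1 : ¬ (j : ℕ) < l - 1 := by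
            unfold kap at hij
            split_ifs at hij <;> omega
          refine mC (hC i i1 i2) (hC j j1 j2) ?_
          rw [Fin.lt_def]
          unfold kap at hij
          split_ifs at hij <;> omega
        · exact (dCT i (hC i i1 i2) j (hT j j2)).2
      · have j2 : ¬ (j : ℕ) < l + k - 4 := by
          unfold kap at hij
          split_ifs at hij <;> omega
        refine aT (hT j j2) (hT i i2) ?_
        rw [Fin.lt_def]
        unfold kap at hij
        split_ifs at hij <;> omega
  set κ := canon n k l hn (by omega) hl with hκ
  have hm : StrictMono (fun x => σ (κ.symm x)) := by
    intro x y hxy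
    apply key
    have h1 : (κ (κ.symm x) : ℕ) = kap k l (κ.symm x) := rfl
    have h2 : (κ (κ.symm y) : ℕ) = kap k l (κ.symm y) := rfl
    rw [← h1, ← h2, Equiv.apply_symm_apply, Equiv.apply_symm_apply]
    exact hxy
  have : (fun x => σ (κ.symm x)) = id := by
    apply (StrictMono.range_inj hm strictMono_id).1
    rw [Set.range_id, Set.range_eq_univ]
    exact σ.surjective.comp κ.symm.surjective
  ext1 x
  have := congrFun this (κ x)
  simpa using this

lemma core {n k l : ℕ} (hn : n + 5 = k + 2 * l) (hk : 4 ≤ k) (hl : 3 ≤ l)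
    (σ : Equiv.Perm (Fin n)) (h : QC k l σ) {D₁ D₂ : Finset (Fin n)} (hD₁ : Dec σ (l-1) D₁)
    (hD₂ : Dec σ (l-1) D₂) (hdis : Disjoint D₁ D₂) :
    σ = canon n k l hn (by omega) hl := by
  obtain ⟨hai, had, ⟨I_R, D_R, hIR, hDR, hR⟩, ⟨D_L, I_L, hDL, hIL, hL⟩,
    ⟨I_T, D_T, hIT, hDT, hT⟩, ⟨D_B, I_B, hDB, hIB, hB⟩⟩ := h
  obtain ⟨r, hr⟩ : ((D₁ ∪ D₂)ᶜ).Nonempty := by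
    rw [← card_pos, (struct hn hk hl hD₁ hD₂ hdis hIR).1]; omega
  have hrI : ∀ I, Inc σ (k-1) I → r ∈ I := fun I hI => (struct hn hk hl hD₁ hD₂ hdis hI).2.1 hr
  -- disjointness
  have disBT : Disjoint D_B D_T := by
    rw [disjoint_left]
    intro p hp hp'
    have e : p = r := le_antisymm (hB p hp r (hrI _ hIB)) (hT r (hrI _ hIT) p hp')
    subst e
    exact hai (chain_incr (by omega) hIT hIB (hrI _ hIT) (hrI _ hIB)
      (fun a ha => hT a ha p hp') (fun b hb => hB p hp b hb))
  have disLR : Disjoint D_L D_R := by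
    rw [disjoint_left]
    intro p hp hp'
    have e : p = r := σ.injective
      (le_antisymm (hL p hp r (hrI _ hIL)) (hR r (hrI _ hIR) p hp'))
    subst e
    exact hai (chain_incr (by omega) hIR hIL (hrI _ hIR) (hrI _ hIL)
      (fun a ha => (hIR.2.le_iff_le ha (hrI _ hIR)).1 (hR a ha p hp'))
      (fun b hb => (hIL.2.le_iff_le (hrI _ hIL) hb).1 (hL p hp b hb)))
  have sBT := fun I hI => struct hn hk hl hDB hDT disBT (I := I) hI
  have sLR := fun I hI => struct hn hk hl hDL hDR disLR (I := I) hI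
  set C := (D_B ∪ D_T)ᶜ with hC
  set C' := (D_L ∪ D_R)ᶜ with hC'
  have pBC : ∀ x ∈ D_B, ∀ y ∈ C, x < y := by
    intro x hx y hy
    refine lt_of_le_of_ne (hB x hx y ((sBT _ hIB).2.1 hy)) ?_
    rintro rfl
    simp [hC, hx] at hy
  have pCT : ∀ x ∈ C, ∀ y ∈ D_T, x < y := by
    intro x hx y hy
    refine lt_of_le_of_ne (hT x ((sBT _ hIT).2.1 hx) y hy) ?_
    rintro rfl
    simp [hC, hy] at hx
  have vLC : ∀ x ∈ D_L, ∀ y ∈ C', σ x < σ y := by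
    intro x hx y hy
    refine lt_of_le_of_ne (hL x hx y ((sLR _ hIL).2.1 hy)) ?_
    intro e
    have := σ.injective e
    subst this
    simp [hC', hx] at hy
  have vCR : ∀ x ∈ C', ∀ y ∈ D_R, σ x < σ y := by
    intro x hx y hy
    refine lt_of_le_of_ne (hR x ((sLR _ hIR).2.1 hx) y hy) ?_
    intro e
    have := σ.injective e
    subst this
    simp [hC', hy] at hx
  obtain ⟨cC, CI, a, ha, c, hc, haI, hcI, hI⟩ := sBT I_T hIT
  obtain ⟨cC', CI', a', ha', c', hc', haI', hcI', hI'⟩ := sLR I_T hIT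
  have hCne : C.Nonempty := by rw [← card_pos, cC]; omega
  have hCne' : C'.Nonempty := by rw [← card_pos, cC']; omega
  obtain ⟨s, hs⟩ := hCne
  obtain ⟨s', hs'⟩ := hCne'
  have pac : a < c := (pBC a ha s hs).trans (pCT s hs c hc)
  have pac' : a' < c' := (hIT.2.lt_iff_lt haI' hcI').1
    ((vLC a' ha' s' hs').trans (vCR s' hs' c' hc'))
  have hCC : C ⊆ C' := by
    intro x hx
    have hxI := CI hx
    have hax := pBC a ha x hx
    have hxc := pCT x hx c hc
    rcases hI' x hxI with rfl | rfl | h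
    · exfalso
      rcases hI' a haI with rfl | rfl | h
      · exact lt_irrefl _ hax
      · exact lt_asymm hax pac'
      · exact lt_asymm hax ((hIT.2.lt_iff_lt hxI haI).1 (vLC x ha' a h))
    · exfalso
      rcases hI' c hcI with rfl | rfl | h
      · exact lt_asymm hxc pac'
      · exact lt_irrefl _ hxc
      · exact lt_asymm hxc ((hIT.2.lt_iff_lt hcI hxI).1 (vCR c h x hc'))
    · exact h
  have hCeq : C = C' := eq_of_subset_of_card_le hCC (by omega)
  have hU : ∀ x, (x ∈ D_B ∨ x ∈ D_T) ↔ (x ∈ D_L ∨ x ∈ D_R) := by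
    intro x
    rw [← mem_union, ← mem_union, ← not_iff_not, ← mem_compl, ← mem_compl, ← hC, ← hC', hCeq]
  have pBT : ∀ x ∈ D_B, ∀ y ∈ D_T, x < y := fun x hx y hy =>
    (pBC x hx s hs).trans (pCT s hs y hy)
  have vLR : ∀ x ∈ D_L, ∀ y ∈ D_R, σ x < σ y := fun x hx y hy =>
    (vLC x hx s' hs').trans (vCR s' hs' y hy)
  have hBL : D_B ⊆ D_L := by
    intro z hz
    by_contra hzL
    have hzR : z ∈ D_R := ((hU z).1 (Or.inl hz)).resolve_left hzL
    have hlt : ∀ w ∈ D_L, z < w := by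
      intro w hw
      rcases (hU w).2 (Or.inl hw) with h | h
      · exact (hDB.2.lt_iff_gt h hz).1 (vLR w hw z hzR)
      · exact pBT z hz w h
    refine had ⟨insert z D_L, by rw [card_insert_of_notMem hzL, hDL.1]; omega, ?_⟩
    intro x hx y hy hxy
    simp only [coe_insert, Set.mem_insert_iff, mem_coe] at hx hy
    rcases hx with rfl | hx <;> rcases hy with rfl | hy
    · exact absurd hxy (lt_irrefl _)
    · exact vLR y hy x hzR
    · exact absurd hxy (lt_asymm (hlt x hx))
    · exact hDL.2 hx hy hxy
  have eBL : D_B = D_L := eq_of_subset_of_card_le hBL (by rw [hDL.1, hDB.1])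
  have hTR : D_T ⊆ D_R := by
    intro z hz
    rcases (hU z).1 (Or.inr hz) with h | h
    · rw [← eBL] at h
      exact absurd hz (disjoint_left.1 disBT h)
    · exact h
  refine eq_canon hn hk hl σ (B := D_B) (C := C) (T := D_T) hDB.1 cC ?_ ?_ ?_ ?_ hDB.2 ?_ hDT.2
  · intro x
    by_cases h1 : x ∈ D_B
    · exact Or.inl h1
    by_cases h2 : x ∈ D_T
    · exact Or.inr (Or.inr h2)
    · exact Or.inr (Or.inl (by simp [hC, h1, h2]))
  · exact fun x hx y hy => ⟨pBC x hx y hy, vLC x (hBL hx) y (hCC hy)⟩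
  · exact fun x hx y hy => ⟨pBT x hx y hy, vLR x (hBL hx) y (hTR hy)⟩
  · exact fun x hx y hy => ⟨pCT x hx y hy, vCR x (hCC hx) y (hTR hy)⟩
  · exact hIT.2.mono (coe_subset.2 CI)

/-- either two disjoint decreasing or two disjoint increasing sequences. -/
lemma dichotomy {n k l : ℕ} (hk : 3 ≤ k) (σ : Fin n → Fin n) (h : QC k l σ) :
    (∃ D E, Dec σ (l-1) D ∧ Dec σ (l-1) E ∧ Disjoint D E) ∨
    (∃ I J, Inc σ (k-1) I ∧ Inc σ (k-1) J ∧ Disjoint I J) := by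
  obtain ⟨I_T, D_T, hIT, hDT, hT⟩ := h.T
  obtain ⟨D_B, I_B, hDB, hIB, hB⟩ := h.B
  by_cases hd : Disjoint D_B D_T
  · exact Or.inl ⟨_, _, hDB, hDT, hd⟩
  right
  refine ⟨_, _, hIT, hIB, ?_⟩
  rw [not_disjoint_iff] at hd
  obtain ⟨p, hp, hp'⟩ := hd
  rw [disjoint_left]
  intro x hx hx'
  have e : x = p := le_antisymm (hT x hx p hp') (hB p hp x hx')
  subst e
  exact h.ai (chain_incr hk hIT hIB hx hx' (fun a ha => hT a ha x hp') (fun b hb => hB x hp b hb))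

lemma inc_disj_bound {n k l : ℕ} {σ : Fin n → Fin n} {I J D : Finset (Fin n)}
    (hI : Inc σ (k-1) I) (hJ : Inc σ (k-1) J) (hD : Dec σ (l-1) D) (hd : Disjoint I J) :
    (k - 1) + (k - 1) + (l - 1) ≤ n + 2 := by
  have h1 := inter_le hI hD
  have h2 := inter_le hJ hD
  have h3 : ((I ∪ J) ∩ D).card ≤ 2 := by
    rw [union_inter_distrib_right]
    exact (card_union_le _ _).trans (by omega)
  have h4 := card_union_add_card_inter (I ∪ J) D
  rw [card_union_of_disjoint hd, hI.1, hJ.1, hD.1] at h4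
  have h5 := card_le_univ (I ∪ J ∪ D)
  rw [Fintype.card_fin] at h5
  omega

/-- reversal -/
def rv {n : ℕ} (σ : Equiv.Perm (Fin n)) : Equiv.Perm (Fin n) := Fin.revPerm.trans σ

lemma rv_apply {n : ℕ} (σ : Equiv.Perm (Fin n)) (x : Fin n) : rv σ x = σ x.rev := rfl

lemma rv_rv {n : ℕ} (σ : Equiv.Perm (Fin n)) : rv (rv σ) = σ := by
  ext x; simp [rv_apply]

lemma inc_rv {n m : ℕ} {σ : Equiv.Perm (Fin n)} {S : Finset (Fin n)} (h : Inc σ m S) :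
    Dec (rv σ) m (S.map Fin.revPerm.toEmbedding) := by
  refine ⟨by rw [card_map, h.1], ?_⟩
  intro x hx y hy hxy
  simp only [coe_map, Set.mem_image, mem_coe] at hx hy
  obtain ⟨a, ha, rfl⟩ := hx
  obtain ⟨b, hb, rfl⟩ := hy
  simp [rv_apply] at hxy ⊢
  exact h.2 hb ha hxy

lemma dec_rv {n m : ℕ} {σ : Equiv.Perm (Fin n)} {S : Finset (Fin n)} (h : Dec σ m S) :
    Inc (rv σ) m (S.map Fin.revPerm.toEmbedding) := by
  refine ⟨by rw [card_map, h.1], ?_⟩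
  intro x hx y hy hxy
  simp only [coe_map, Set.mem_image, mem_coe] at hx hy
  obtain ⟨a, ha, rfl⟩ := hx
  obtain ⟨b, hb, rfl⟩ := hy
  simp [rv_apply] at hxy ⊢
  exact h.2 hb ha hxy

lemma qc_rv {n k l : ℕ} {σ : Equiv.Perm (Fin n)} (h : QC k l σ) : QC l k (rv σ) := by
  obtain ⟨hai, had, ⟨I_R, D_R, hIR, hDR, hR⟩, ⟨D_L, I_L, hDL, hIL, hL⟩,
    ⟨I_T, D_T, hIT, hDT, hT⟩, ⟨D_B, I_B, hDB, hIB, hB⟩⟩ := h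
  refine ⟨?_, ?_, ⟨_, _, dec_rv hDL, inc_rv hIL, ?_⟩, ⟨_, _, inc_rv hIR, dec_rv hDR, ?_⟩,
    ⟨_, _, dec_rv hDT, inc_rv hIT, ?_⟩, ⟨_, _, inc_rv hIB, dec_rv hDB, ?_⟩⟩
  · rintro ⟨S, hS⟩
    have := inc_rv hS
    rw [rv_rv] at this
    exact had ⟨_, this⟩
  · rintro ⟨S, hS⟩
    have := dec_rv hS
    rw [rv_rv] at this
    exact hai ⟨_, this⟩
  · simp only [mem_map_equiv]
    exact fun x hx y hy => hL _ hx _ hy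
  · simp only [mem_map_equiv]
    exact fun x hx y hy => hR _ hx _ hy
  · simp only [mem_map_equiv]
    exact fun x hx y hy => Fin.rev_le_rev.1 (hT _ hy _ hx)
  · simp only [mem_map_equiv]
    exact fun x hx y hy => Fin.rev_le_rev.1 (hB _ hy _ hx)

lemma canon_qc {n k l : ℕ} (hn : n + 5 = k + 2 * l) (hk : 3 ≤ k) (hl : 3 ≤ l) :
    QC k l (canon n k l hn hk hl) := by
  set κ := canon n k l hn hk hl with hκ
  have hv : ∀ i, (κ i : ℕ) = kap k l i := fun i => rfl
  have b1 : Dec κ (l-1) (Icc ⟨0, by omega⟩ ⟨l-2, by omega⟩) := by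
    refine ⟨by rw [Fin.card_Icc]; simp; omega, ?_⟩
    intro x hx y hy hxy
    have := x.isLt
    have := y.isLt
    simp only [coe_Icc, Set.mem_Icc, Fin.le_def, Fin.lt_def, hv] at hx hy hxy ⊢
    unfold kap
    split_ifs <;> omega
  have b3 : Dec κ (l-1) (Icc ⟨l+k-4, by omega⟩ ⟨n-1, by omega⟩) := by
    refine ⟨by rw [Fin.card_Icc]; simp; omega, ?_⟩
    intro x hx y hy hxy
    have := x.isLt
    have := y.isLt
    simp only [coe_Icc, Set.mem_Icc, Fin.le_def, Fin.lt_def, hv] at hx hy hxy ⊢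
    unfold kap
    split_ifs <;> omega
  have j1 : Inc κ (k-1) (Icc ⟨l-2, by omega⟩ ⟨l+k-4, by omega⟩) := by
    refine ⟨by rw [Fin.card_Icc]; simp; omega, ?_⟩
    intro x hx y hy hxy
    have := x.isLt
    have := y.isLt
    simp only [coe_Icc, Set.mem_Icc, Fin.le_def, Fin.lt_def, hv] at hx hy hxy ⊢
    unfold kap
    split_ifs <;> omega
  have j2 : Inc κ (k-1) (insert ⟨0, by omega⟩ (insert ⟨n-1, by omega⟩
      (Ico ⟨l-1, by omega⟩ ⟨l+k-4, by omega⟩))) := by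
    refine ⟨?_, ?_⟩
    · rw [card_insert_of_notMem, card_insert_of_notMem, Fin.card_Ico]
      · simp; omega
      · simp; omega
      · simp; omega
    intro x hx y hy hxy
    have := x.isLt
    have := y.isLt
    simp only [coe_insert, Set.mem_insert_iff, coe_Ico, Set.mem_Ico, Fin.ext_iff, Fin.le_def,
      Fin.lt_def, hv] at hx hy hxy ⊢
    unfold kap
    split_ifs <;> omega
  refine ⟨?_, ?_, ⟨_, _, j2, b3, ?_⟩, ⟨_, _, b1, j2, ?_⟩, ⟨_, _, j1, b3, ?_⟩, ⟨_, _, b1, j1, ?_⟩⟩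
  · rintro ⟨S, hc, hS⟩
    have : S.card ≤ (Icc (l-2) (l+k-4)).card := by
      apply card_le_card_of_injOn (fun i : Fin n => max (l-2) (min (i:ℕ) (l+k-4)))
      · intro i hi
        simp only [coe_Icc, Set.mem_Icc]
        omega
      · have key : ∀ x ∈ S, ∀ y ∈ S, x < y →
            max (l-2) (min (x:ℕ) (l+k-4)) ≠ max (l-2) (min (y:ℕ) (l+k-4)) := by
          intro x hx y hy hxy
          have h1 := hS hx hy hxy
          have := x.isLt
          have := y.isLt
          rw [Fin.lt_def] at hxy h1
          rw [hv, hv] at h1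
          unfold kap at h1
          split_ifs at h1 <;> omega
        intro x hx y hy hxy
        by_contra hne
        rcases lt_or_gt_of_ne hne with h | h
        · exact key x hx y hy h hxy
        · exact key y hy x hx h hxy.symm
    rw [Nat.card_Icc, hc] at this
    omega
  · rintro ⟨S, hc, hS⟩
    have : S.card ≤ (range (l-1)).card := by
      apply card_le_card_of_injOn (fun i : Fin n => if (i:ℕ) + 1 < l then (i:ℕ) else
        if (i:ℕ) + 4 < l + k then 0 else (i:ℕ) - (l+k-4))
      · intro i hi
        have := i.isLt
        simp only [coe_range, Set.mem_Iio]
        split_ifs <;> omega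
      · have key : ∀ x ∈ S, ∀ y ∈ S, x < y →
            (if (x:ℕ) + 1 < l then (x:ℕ) else if (x:ℕ) + 4 < l + k then 0 else (x:ℕ) - (l+k-4)) ≠
            (if (y:ℕ) + 1 < l then (y:ℕ) else if (y:ℕ) + 4 < l + k then 0 else (y:ℕ) - (l+k-4)) := by
          intro x hx y hy hxy
          have h1 := hS hx hy hxy
          have := x.isLt
          have := y.isLt
          rw [Fin.lt_def] at hxy h1
          rw [hv, hv] at h1
          unfold kap at h1
          split_ifs at h1 ⊢ <;> omega
        intro x hx y hy hxy
        by_contra hne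
        rcases lt_or_gt_of_ne hne with h | h
        · exact key x hx y hy h hxy
        · exact key y hy x hx h hxy.symm
    rw [card_range, hc] at this
    omega
  all_goals
    intro x hx y hy
    have := x.isLt
    have := y.isLt
    simp only [mem_insert, mem_Ico, mem_Icc, Fin.ext_iff, Fin.le_def, Fin.lt_def, hv] at hx hy ⊢
    try unfold kap
    try split_ifs
    all_goals omega

instance {n m : ℕ} (σ : Fin n → Fin n) (S : Finset (Fin n)) : Decidable (Inc σ m S) :=
  decidable_of_iff (S.card = m ∧ ∀ a ∈ S, ∀ b ∈ S, a < b → σ a < σ b)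
    ⟨fun h => ⟨h.1, fun a ha b hb hab => h.2 a ha b hb hab⟩,
     fun h => ⟨h.1, fun _ ha _ hb hab => h.2 ha hb hab⟩⟩

instance {n m : ℕ} (σ : Fin n → Fin n) (S : Finset (Fin n)) : Decidable (Dec σ m S) :=
  decidable_of_iff (S.card = m ∧ ∀ a ∈ S, ∀ b ∈ S, a < b → σ b < σ a)
    ⟨fun h => ⟨h.1, fun a ha b hb hab => h.2 a ha b hb hab⟩,
     fun h => ⟨h.1, fun _ ha _ hb hab => h.2 ha hb hab⟩⟩

set_option synthInstance.maxSize 2000 in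
set_option synthInstance.maxHeartbeats 400000 in
instance {n k l : ℕ} (σ : Fin n → Fin n) : Decidable (QC k l σ) :=
  decidable_of_iff ((¬ ∃ S, Inc σ k S) ∧ (¬ ∃ S, Dec σ l S) ∧
    (∃ I, Inc σ (k-1) I ∧ ∃ D, Dec σ (l-1) D ∧ ∀ x ∈ I, ∀ y ∈ D, σ x ≤ σ y) ∧
    (∃ D, Dec σ (l-1) D ∧ ∃ I, Inc σ (k-1) I ∧ ∀ x ∈ D, ∀ y ∈ I, σ x ≤ σ y) ∧
    (∃ I, Inc σ (k-1) I ∧ ∃ D, Dec σ (l-1) D ∧ ∀ x ∈ I, ∀ y ∈ D, x ≤ y) ∧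
    (∃ D, Dec σ (l-1) D ∧ ∃ I, Inc σ (k-1) I ∧ ∀ x ∈ D, ∀ y ∈ I, x ≤ y))
    ⟨fun ⟨a, b, ⟨c, h1, d, h2⟩, ⟨c', h1', d', h2'⟩, ⟨e, h3, f, h4⟩, ⟨e', h3', f', h4'⟩⟩ =>
      ⟨a, b, ⟨c, d, h1, h2⟩, ⟨c', d', h1', h2'⟩, ⟨e, f, h3, h4⟩, ⟨e', f', h3', h4'⟩⟩,
     fun ⟨a, b, ⟨c, d, h1, h2⟩, ⟨c', d', h1', h2'⟩, ⟨e, f, h3, h4⟩, ⟨e', f', h3', h4'⟩⟩ =>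
      ⟨a, b, ⟨c, h1, d, h2⟩, ⟨c', h1', d', h2'⟩, ⟨e, h3, f, h4⟩, ⟨e', h3', f', h4'⟩⟩⟩

lemma card33 : Nat.card {σ : Equiv.Perm (Fin 4) // QC 3 3 σ} = 4 := by
  rw [Nat.card_eq_fintype_card, Fintype.card_subtype]
  decide +kernel

lemma main {n k l : ℕ} (hn : n + 5 = k + 2 * l) (hl : 3 ≤ l) (hkl : l ≤ k) :
    Nat.card {σ : Equiv.Perm (Fin n) // QC k l σ} =
      if k = l then (if k = 3 then 4 else 2) else 1 := by
  by_cases hkeq : k = l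
  · subst hkeq
    by_cases hk3 : k = 3
    · subst hk3
      have : n = 4 := by omega
      subst this
      simpa using card33
    · have hS : {σ : Equiv.Perm (Fin n) | QC k k σ} =
          {canon n k k hn hl hl, rv (canon n k k hn hl hl)} := by
        ext σ
        simp only [Set.mem_ofPred_eq, Set.mem_insert_iff, Set.mem_singleton_iff]
        constructor
        · intro h
          rcases dichotomy hl σ h with ⟨D, E, hD, hE, hd⟩ | ⟨I, J, hI, hJ, hd⟩
          · exact Or.inl (core hn (by omega) hl σ h hD hE hd)
          · right
            rw [← core hn (by omega) hl (rv σ) (qc_rv h) (inc_rv hI) (inc_rv hJ)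
              ((disjoint_map _).2 hd), rv_rv]
        · rintro (rfl | rfl)
          · exact canon_qc hn hl hl
          · exact qc_rv (canon_qc hn hl hl)
      have hne : canon n k k hn hl hl ≠ rv (canon n k k hn hl hl) := by
        intro h
        have h1 := congrArg (fun σ : Equiv.Perm (Fin n) => (σ ⟨0, by omega⟩ : ℕ)) h
        simp only [rv_apply, canon_val, Fin.val_rev, kap] at h1
        split_ifs at h1 <;> omega
      have h2 := Set.ncard_pair hne
      rw [← hS] at h2
      simp only [if_true, if_neg hk3]
      exact h2
  · have hS : {σ : Equiv.Perm (Fin n) | QC k l σ} = {canon n k l hn (by omega) hl} := by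
      ext σ
      simp only [Set.mem_ofPred_eq, Set.mem_singleton_iff]
      constructor
      · intro h
        rcases dichotomy (by omega) σ h with ⟨D, E, hD, hE, hd⟩ | ⟨I, J, hI, hJ, hd⟩
        · exact core hn (by omega) hl σ h hD hE hd
        · obtain ⟨_, D, _, hD, _⟩ := h.R
          have := inc_disj_bound hI hJ hD hd
          omega
      · rintro rfl
        exact canon_qc hn (by omega) hl
    have h2 := Set.ncard_singleton (canon n k l hn (by omega) hl)
    rw [← hS] at h2
    rw [if_neg hkeq]
    exact h2

end QCaux

/-- count of minimal quadrocrucial permutations: for `k ≥ l ≥ 3`, the number of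
`(k,l)`-quadrocrucial permutations of the minimal length `k+2l-5` equals `4` if `k = l = 3`,
`2` if `k = l > 3`, and `1` if `k > l`. -/
theorem count_minimal_quadrocrucial (k l : ℕ) (hl : 3 ≤ l) (hkl : l ≤ k) :
    Nat.card {σ : Equiv.Perm (Fin (k + 2 * l - 5)) // Quadrocrucial k l (k + 2 * l - 5) ⇑σ} =
      if k = l then (if k = 3 then 4 else 2) else 1 := by
  simp only [QCaux.quad_iff (show 2 ≤ k by omega) (show 2 ≤ l by omega)]
  exact QCaux.main (by omega) hl hkl
end
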